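/- arXiv:1403.2457 — 5 statements merged into one kernel-verified Lean document; each statement's English description precedes it below -/
import Mathlib

section
/- Let T be an invertible weak mixing measure-preserving transformation of a Lebesgue probability space (X, S, μ) and let C ⊆ S be a family of measurable sets with H_μ(C) > 0. Then there exists a dense G_δ set G ⊂ Φ such that for each φ ∈ G, letting T_φ = φ^{-1} ∘ T ∘ φ, one has limsup_{n→∞} sup_{C ∈ C} (1/n) Σ_{i=0}^{n-1} |μ(C ∩ T_φ^{-i} C) − μ(C)²| > 0. -/
open MeasureTheory Filter

/-- Entropy (base 2) of the join of the sets `C 0, …, C (n-1)`: the cells of the join are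
indexed by sign patterns `s : Fin n → Bool`; cells of measure zero contribute `0`. -/
noncomputable def joinEntropy {X : Type*} [MeasurableSpace X] (μ : Measure X)
    {n : ℕ} (C : Fin n → Set X) : ℝ :=
  ∑ s : Fin n → Bool,
    -((μ (⋂ i, if s i then C i else (C i)ᶜ)).toReal *
      Real.logb 2 (μ (⋂ i, if s i then C i else (C i)ᶜ)).toReal)

/-- Entropy of a family `𝒞` of measurable sets: the supremum over all sequences of sets
from `𝒞` of `liminf (1/n) H_μ(⋁_{i<n} C_i)`. -/
noncomputable def famEntropy {X : Type*} [MeasurableSpace X] (μ : Measure X)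
    (𝒞 : Set (Set X)) : ℝ :=
  ⨆ S : {f : ℕ → Set X // ∀ i, f i ∈ 𝒞},
    Filter.liminf (fun n : ℕ => joinEntropy μ (fun i : Fin n => S.1 i) / n) Filter.atTop

/-- The mean deviation `∫ |(1/n) ∑_{i<n} 1_C(T^i x) − μ(C)| dμ` of the Birkhoff average. -/
noncomputable def birkDev {X : Type*} [MeasurableSpace X] (μ : Measure X)
    (T : X → X) (C : Set X) (n : ℕ) : ℝ :=
  ∫ x, |(∑ i ∈ Finset.range n, C.indicator (fun _ => (1 : ℝ)) (T^[i] x)) / n - (μ C).toReal| ∂μ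

/-- The invertible measure preserving transformations of `(X, 𝒮, μ)` (representatives of
the equivalence classes mod 0). -/
def MPE {X : Type*} [MeasurableSpace X] (μ : Measure X) : Type _ :=
  {e : X ≃ᵐ X // MeasurePreserving e μ μ}

/-- The weak topology on the invertible measure preserving transformations:
`φ_r → φ` iff `μ (φ_r A ∆ φ A) → 0` for every measurable set `A`.  It is realized as the
topology induced by the maps `φ ↦ 1_{φ A} ∈ L¹(μ)` for measurable `A` (note that
`φ A = φ.symm ⁻¹' A`, and `‖1_{φ' A} - 1_{φ A}‖₁ = μ (φ' A ∆ φ A)`). -/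
noncomputable instance MPE.topologicalSpace {X : Type*} [MeasurableSpace X]
    {μ : Measure X} [IsFiniteMeasure μ] : TopologicalSpace (MPE μ) :=
  TopologicalSpace.induced
    (fun φ : MPE μ => fun A : {A : Set X // MeasurableSet A} =>
      (indicatorConstLp 1 (A.2.preimage φ.1.symm.measurable) (measure_ne_top μ _)
        (1 : ℝ) : Lp ℝ 1 μ))
    inferInstance

/-- The conjugate transformation `T_φ = φ⁻¹ ∘ T ∘ φ`. -/
def MPE.conj {X : Type*} [MeasurableSpace X] {μ : Measure X}
    (T : X ≃ᵐ X) (φ : MPE μ) : X → X :=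
  fun x => φ.1.symm (T (φ.1 x))

noncomputable def wmDev {X : Type*} [MeasurableSpace X] (μ : Measure X)
    (T : X → X) (C : Set X) (n : ℕ) : ℝ :=
  (∑ i ∈ Finset.range n, |(μ (C ∩ T^[i] ⁻¹' C)).toReal - (μ C).toReal ^ 2|) / n

lemma integrable_of_meas_bdd {X : Type*} [MeasurableSpace X] (μ : Measure X)
    [IsFiniteMeasure μ] {f : X → ℝ} (hf : Measurable f) (K : ℝ) (hK : ∀ x, |f x| ≤ K) :
    Integrable f μ :=
  Integrable.of_bound hf.aestronglyMeasurable K (Eventually.of_forall hK)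

lemma double_sum_le (n : ℕ) (a : ℕ → ℝ) (ha : ∀ k, 0 ≤ a k) :
    ∑ i ∈ Finset.range n, ∑ j ∈ Finset.range n, a ((i - j) + (j - i)) ≤
      2 * n * ∑ k ∈ Finset.range n, a k := by
  have h1 : ∀ i ∈ Finset.range n, ∑ j ∈ Finset.range n, a ((i - j) + (j - i)) ≤
      2 * ∑ k ∈ Finset.range n, a k := by
    intro i hi
    calc ∑ j ∈ Finset.range n, a ((i - j) + (j - i))
        ≤ ∑ j ∈ Finset.range n, ∑ k ∈ Finset.range n,
          ((if j + k = i then a k else 0) + (if i + k = j then a k else 0)) := by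
          apply Finset.sum_le_sum
          intro j hj
          have hk : (i - j) + (j - i) ∈ Finset.range n := by
            simp only [Finset.mem_range] at *; omega
          refine le_trans ?_ (Finset.single_le_sum (f := fun k =>
            ((if j + k = i then a k else 0) + (if i + k = j then a k else 0))) ?_ hk)
          · rcases le_total i j with h | h
            · have : i + ((i - j) + (j - i)) = j := by omega
              simp only [this, if_true]
              have : 0 ≤ (if j + (i - j + (j - i)) = i then a (i - j + (j - i)) else 0) := by
                split_ifs <;> simp [ha]
              linarith
            · have : j + ((i - j) + (j - i)) = i := by omega
              simp only [this, if_true]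
              have : 0 ≤ (if i + (i - j + (j - i)) = j then a (i - j + (j - i)) else 0) := by
                split_ifs <;> simp [ha]
              linarith
          · intro k _
            have := ha k
            apply add_nonneg <;> split_ifs <;> simp [this]
      _ = ∑ k ∈ Finset.range n, ∑ j ∈ Finset.range n,
          ((if j + k = i then a k else 0) + (if i + k = j then a k else 0)) := Finset.sum_comm
      _ ≤ ∑ k ∈ Finset.range n, 2 * a k := by
          apply Finset.sum_le_sum
          intro k _
          rw [Finset.sum_add_distrib]
          have e1 : ∑ j ∈ Finset.range n, (if j + k = i then a k else 0) ≤ a k := by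
            calc _ ≤ ∑ j ∈ Finset.range n, (if j = i - k then a k else 0) := by
                  apply Finset.sum_le_sum
                  intro j _
                  have := ha k
                  split_ifs <;> first | rfl | assumption | omega
              _ ≤ a k := by
                  rw [Finset.sum_ite_eq']; have := ha k; split_ifs <;> simp [this]
          have e2 : ∑ j ∈ Finset.range n, (if i + k = j then a k else 0) ≤ a k := by
            rw [Finset.sum_ite_eq]; have := ha k; split_ifs <;> simp [this]
          linarith
      _ = _ := by rw [Finset.mul_sum]
  calc _ ≤ ∑ i ∈ Finset.range n, 2 * ∑ k ∈ Finset.range n, a k := Finset.sum_le_sum h1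
    _ = _ := by simp; ring

lemma corr_bound {X : Type*} [MeasurableSpace X] (μ : Measure X) [IsProbabilityMeasure μ]
    (T : X → X) (hT : MeasurePreserving T μ μ) {B E : Set X} (hB : MeasurableSet B)
    (hE : MeasurableSet E) (n : ℕ) (hn : 0 < n) (d : ℝ)
    (hd : μ.real (T ⁻¹' E \ E) + μ.real (E \ T ⁻¹' E) ≤ d) :
    |μ.real (B ∩ E) - μ.real B * μ.real E| ≤ Real.sqrt (2 * wmDev μ T B n) + n * d := by
  classical
  set b := μ.real B with hb
  have hb0 : 0 ≤ b := measureReal_nonneg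
  have hb1 : b ≤ 1 := measureReal_le_one
  set f : X → ℝ := fun x => B.indicator (fun _ => (1:ℝ)) x - b with hf
  set g : X → ℝ := E.indicator (fun _ => (1:ℝ)) with hg
  have hfm : Measurable f := (measurable_const.indicator hB).sub_const b
  have hgm : Measurable g := measurable_const.indicator hE
  have hf1 : ∀ x, |f x| ≤ 1 := by
    intro x
    simp only [hf, Set.indicator]
    split_ifs <;> rw [abs_le] <;> constructor <;> linarith
  have hg1 : ∀ x, |g x| ≤ 1 := by
    intro x
    simp only [hg, Set.indicator]
    split_ifs <;> simp
  have hTi : ∀ i, MeasurePreserving (T^[i]) μ μ := fun i => hT.iterate i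
  have hfi : ∀ i, Measurable (fun x => f (T^[i] x)) := fun i => hfm.comp (hTi i).measurable
  have hgi : ∀ i, Measurable (fun x => g (T^[i] x)) := fun i => hgm.comp (hTi i).measurable
  -- change of variables
  have cov : ∀ (i : ℕ) (h : X → ℝ), Measurable h → ∫ x, h (T^[i] x) ∂μ = ∫ x, h x ∂μ := by
    intro i h hh
    have := integral_map (μ := μ) (hTi i).measurable.aemeasurable
      (f := h) hh.aestronglyMeasurable
    rw [(hTi i).map_eq] at this
    exact this.symm
  -- correlation
  have corr0 : ∀ k, ∫ x, f x * f (T^[k] x) ∂μ = μ.real (B ∩ T^[k] ⁻¹' B) - b ^ 2 := by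
    intro k
    have hBk : MeasurableSet (T^[k] ⁻¹' B) := (hTi k).measurable hB
    have e : ∀ x, f x * f (T^[k] x) = (B ∩ T^[k] ⁻¹' B).indicator (fun _ => (1:ℝ)) x
        - b * B.indicator (fun _ => (1:ℝ)) x - b * (T^[k] ⁻¹' B).indicator (fun _ => (1:ℝ)) x
        + b ^ 2 := by
      intro x
      by_cases h1 : x ∈ B <;> by_cases h2 : T^[k] x ∈ B <;>
        simp [hf, Set.indicator, h1, h2] <;> ring
    have i1 : Integrable ((B ∩ T^[k] ⁻¹' B).indicator (fun _ => (1:ℝ))) μ :=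
      (integrable_const _).indicator (hB.inter hBk)
    have i2 : Integrable (B.indicator (fun _ => (1:ℝ))) μ :=
      (integrable_const _).indicator hB
    have i3 : Integrable ((T^[k] ⁻¹' B).indicator (fun _ => (1:ℝ))) μ :=
      (integrable_const _).indicator hBk
    simp_rw [e]
    have j1 : Integrable (fun x => (B ∩ T^[k] ⁻¹' B).indicator (fun _ => (1:ℝ)) x
        - b * B.indicator (fun _ => (1:ℝ)) x) μ := i1.sub (i2.const_mul b)
    have j2 : Integrable (fun x => (B ∩ T^[k] ⁻¹' B).indicator (fun _ => (1:ℝ)) x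
        - b * B.indicator (fun _ => (1:ℝ)) x
        - b * (T^[k] ⁻¹' B).indicator (fun _ => (1:ℝ)) x) μ := j1.sub (i3.const_mul b)
    rw [integral_add j2 (integrable_const _),
      integral_sub j1 (i3.const_mul b), integral_sub i1 (i2.const_mul b),
      integral_const_mul, integral_const_mul, integral_indicator_const _ (hB.inter hBk),
      integral_indicator_const _ hB, integral_indicator_const _ hBk]
    have : μ.real (T^[k] ⁻¹' B) = b := (hTi k).measureReal_preimage hB.nullMeasurableSet
    rw [this]
    simp
    ring
  have corr : ∀ i j, ∫ x, f (T^[i] x) * f (T^[j] x) ∂μ =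
      μ.real (B ∩ T^[(i - j) + (j - i)] ⁻¹' B) - b ^ 2 := by
    have key : ∀ i k, ∫ x, f (T^[i] x) * f (T^[i + k] x) ∂μ =
        μ.real (B ∩ T^[k] ⁻¹' B) - b ^ 2 := by
      intro i k
      rw [← corr0, ← cov i (fun x => f x * f (T^[k] x)) (hfm.mul (hfi k))]
      congr 1; ext x
      rw [add_comm i k, Function.iterate_add_apply]
    intro i j
    rcases le_total i j with h | h
    · obtain ⟨k, rfl⟩ := Nat.exists_eq_add_of_le h
      rw [key]; congr; omega
    · obtain ⟨k, rfl⟩ := Nat.exists_eq_add_of_le h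
      have : ∫ x, f (T^[j+k] x) * f (T^[j] x) ∂μ = ∫ x, f (T^[j] x) * f (T^[j+k] x) ∂μ := by
        congr 1; ext x; ring
      rw [this, key]; congr; omega
  set S : X → ℝ := fun x => ∑ i ∈ Finset.range n, f (T^[i] x) with hS
  have hSm : Measurable S := Finset.measurable_sum _ (fun i _ => hfi i)
  have hS1 : ∀ x, |S x| ≤ n := by
    intro x
    calc |S x| ≤ ∑ i ∈ Finset.range n, |f (T^[i] x)| := Finset.abs_sum_le_sum_abs _ _
      _ ≤ ∑ i ∈ Finset.range n, (1:ℝ) := Finset.sum_le_sum (fun i _ => hf1 _)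
      _ = n := by simp
  have iprod : ∀ i j, Integrable (fun x => f (T^[i] x) * f (T^[j] x)) μ := by
    intro i j
    refine integrable_of_meas_bdd μ ((hfi i).mul (hfi j)) 1 (fun x => ?_)
    rw [abs_mul]
    exact mul_le_one₀ (hf1 _) (abs_nonneg _) (hf1 _)
  have hn' : (0:ℝ) < n := by exact_mod_cast hn
  have hSS : ∫ x, S x ^ 2 ∂μ ≤ n ^ 2 * (2 * wmDev μ T B n) := by
    have e : ∀ x, S x ^ 2 = ∑ i ∈ Finset.range n, ∑ j ∈ Finset.range n,
        f (T^[i] x) * f (T^[j] x) := by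
      intro x; simp only [hS]; rw [sq, Finset.sum_mul_sum]
    simp_rw [e]
    rw [integral_finsetSum _ (fun i _ => integrable_finsetSum _ (fun j _ => iprod i j))]
    simp_rw [integral_finsetSum _ (fun j _ => iprod _ j), corr]
    calc _ ≤ ∑ i ∈ Finset.range n, ∑ j ∈ Finset.range n,
          |μ.real (B ∩ T^[(i - j) + (j - i)] ⁻¹' B) - b ^ 2| :=
          Finset.sum_le_sum fun i _ => Finset.sum_le_sum fun j _ => le_abs_self _
      _ ≤ 2 * n * ∑ k ∈ Finset.range n, |μ.real (B ∩ T^[k] ⁻¹' B) - b ^ 2| :=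
          double_sum_le n (fun k => |μ.real (B ∩ T^[k] ⁻¹' B) - b ^ 2|) (fun k => abs_nonneg _)
      _ = n ^ 2 * (2 * wmDev μ T B n) := by
          unfold wmDev
          simp only [hb, Measure.real]
          field_simp
  -- Cauchy-Schwarz
  have hCS : |∫ x, S x * g x ∂μ| ≤ n * Real.sqrt (2 * wmDev μ T B n) := by
    set a := ∫ x, S x * g x ∂μ with ha
    have iSg : Integrable (fun x => S x * g x) μ := by
      refine integrable_of_meas_bdd μ (hSm.mul hgm) n (fun x => ?_)
      rw [abs_mul]
      calc _ ≤ (n:ℝ) * 1 := mul_le_mul (hS1 x) (hg1 x) (abs_nonneg _) hn'.le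
        _ = n := by ring
    have iS2 : Integrable (fun x => S x ^ 2) μ := by
      refine integrable_of_meas_bdd μ (hSm.pow_const 2) (n^2) (fun x => ?_)
      rw [abs_pow]
      exact pow_le_pow_left₀ (abs_nonneg _) (hS1 x) 2
    have h0 : 0 ≤ ∫ x, (S x ^ 2 - 2 * a * (S x * g x) + a ^ 2) ∂μ := by
      apply integral_nonneg
      intro x
      have : g x = 0 ∨ g x = 1 := by
        simp only [hg, Set.indicator]; split_ifs <;> simp
      simp only [Pi.zero_apply]
      rcases this with h | h <;> rw [h]
      · nlinarith [sq_nonneg (S x), sq_nonneg a]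
      · nlinarith [sq_nonneg (S x - a)]
    have j1 : Integrable (fun x => S x ^ 2 - 2 * a * (S x * g x)) μ := iS2.sub (iSg.const_mul _)
    rw [integral_add j1 (integrable_const _),
      integral_sub iS2 (iSg.const_mul _), integral_const_mul] at h0
    simp only [integral_const, probReal_univ, one_smul, smul_eq_mul, one_mul] at h0
    have h2 : a ^ 2 ≤ n ^ 2 * (2 * wmDev μ T B n) := by
      rw [← ha] at h0
      nlinarith
    have h3 : |a| ≤ Real.sqrt (n ^ 2 * (2 * wmDev μ T B n)) := Real.abs_le_sqrt h2
    rwa [Real.sqrt_mul (by positivity), Real.sqrt_sq hn'.le] at h3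
  -- almost invariance
  have hstep : ∀ i, ∫ x, |g (T^[i] x) - g x| ∂μ ≤ i * d := by
    have hgT : ∀ i, Integrable (fun x => |g (T^[i] x) - g x|) μ := by
      intro i
      refine integrable_of_meas_bdd μ ((hgi i).sub hgm).abs 2 (fun x => ?_)
      rw [abs_abs]
      calc _ ≤ |g (T^[i] x)| + |g x| := abs_sub _ _
        _ ≤ 2 := by linarith [hg1 (T^[i] x), hg1 x]
    have hone : ∫ x, |g (T x) - g x| ∂μ ≤ d := by
      have e : ∀ x, |g (T x) - g x| = (T ⁻¹' E \ E).indicator (fun _ => (1:ℝ)) x +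
          (E \ T ⁻¹' E).indicator (fun _ => (1:ℝ)) x := by
        intro x
        by_cases h1 : x ∈ E <;> by_cases h2 : T x ∈ E <;> simp [hg, Set.indicator, h1, h2]
      have hTE := hT.measurable hE
      simp_rw [e]
      rw [integral_add ((integrable_const _).indicator (hTE.diff hE))
        ((integrable_const _).indicator (hE.diff hTE)),
        integral_indicator_const _ (hTE.diff hE), integral_indicator_const _ (hE.diff hTE)]
      simpa using hd
    intro i
    induction i with
    | zero => simp
    | succ i ih =>
      have hm : Measurable (fun x => |g (T x) - g x|) :=
        (((hgm.comp hT.measurable)).sub hgm).abs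
      have e2 := cov i (fun x => |g (T x) - g x|) hm
      have i2 : Integrable (fun x => |g (T (T^[i] x)) - g (T^[i] x)|) μ := by
        refine integrable_of_meas_bdd μ (hm.comp (hTi i).measurable) 2 (fun x => ?_)
        simp only [Function.comp, abs_abs]
        calc _ ≤ |g (T (T^[i] x))| + |g (T^[i] x)| := abs_sub _ _
          _ ≤ 2 := by linarith [hg1 (T (T^[i] x)), hg1 (T^[i] x)]
      calc ∫ x, |g (T^[i+1] x) - g x| ∂μ
          ≤ ∫ x, (|g (T (T^[i] x)) - g (T^[i] x)| + |g (T^[i] x) - g x|) ∂μ := by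
            apply integral_mono (hgT _) (i2.add (hgT i))
            intro x
            simp only [Function.iterate_succ_apply']
            exact abs_sub_le _ _ _
        _ ≤ d + i * d := by
            rw [integral_add i2 (hgT i), e2]; linarith
        _ = _ := by push_cast; ring
  have ifg : ∀ i, Integrable (fun x => f (T^[i] x) * g x) μ := by
    intro i
    refine integrable_of_meas_bdd μ ((hfi i).mul hgm) 1 (fun x => ?_)
    rw [abs_mul]
    exact mul_le_one₀ (hf1 _) (abs_nonneg _) (hg1 _)
  set A := ∫ x, f x * g x ∂μ with hA
  have hd0 : 0 ≤ d := le_trans (by positivity) hd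
  have hAi : ∀ i ∈ Finset.range n, |A - ∫ x, f (T^[i] x) * g x ∂μ| ≤ n * d := by
    intro i hi
    have ifg' : Integrable (fun x => f (T^[i] x) * g (T^[i] x)) μ := by
      refine integrable_of_meas_bdd μ ((hfi i).mul (hgi i)) 1 (fun x => ?_)
      rw [abs_mul]
      exact mul_le_one₀ (hf1 _) (abs_nonneg _) (hg1 _)
    rw [hA, ← cov i (fun x => f x * g x) (hfm.mul hgm), ← integral_sub ifg' (ifg i)]
    calc _ ≤ ∫ x, |f (T^[i] x) * g (T^[i] x) - f (T^[i] x) * g x| ∂μ := abs_integral_le_integral_abs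
      _ ≤ ∫ x, |g (T^[i] x) - g x| ∂μ := by
          apply integral_mono (ifg'.sub (ifg i)).abs
          · refine integrable_of_meas_bdd μ ((hgi i).sub hgm).abs 2 (fun x => ?_)
            rw [abs_abs]
            calc _ ≤ |g (T^[i] x)| + |g x| := abs_sub _ _
              _ ≤ 2 := by linarith [hg1 (T^[i] x), hg1 x]
          · intro x
            simp only [Pi.sub_apply]
            rw [← mul_sub, abs_mul]
            exact mul_le_of_le_one_left (abs_nonneg _) (hf1 _)
      _ ≤ i * d := hstep i
      _ ≤ n * d := by
          apply mul_le_mul_of_nonneg_right _ hd0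
          exact_mod_cast (Finset.mem_range.mp hi).le
  have hAeq : A = μ.real (B ∩ E) - b * μ.real E := by
    have e : ∀ x, f x * g x = (B ∩ E).indicator (fun _ => (1:ℝ)) x
        - b * E.indicator (fun _ => (1:ℝ)) x := by
      intro x
      by_cases h1 : x ∈ B <;> by_cases h2 : x ∈ E <;> simp [hf, hg, Set.indicator, h1, h2]
    rw [hA]
    simp_rw [e]
    rw [integral_sub ((integrable_const _).indicator (hB.inter hE))
      (((integrable_const _).indicator hE).const_mul b), integral_const_mul,
      integral_indicator_const _ (hB.inter hE), integral_indicator_const _ hE]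
    simp
  have hsum : ∫ x, S x * g x ∂μ = ∑ i ∈ Finset.range n, ∫ x, f (T^[i] x) * g x ∂μ := by
    rw [← integral_finsetSum _ (fun i _ => ifg i)]
    congr 1; ext x; simp only [hS]; rw [Finset.sum_mul]
  have hfin : |n * A - ∫ x, S x * g x ∂μ| ≤ n * (n * d) := by
    rw [hsum]
    have : n * A - ∑ i ∈ Finset.range n, ∫ x, f (T^[i] x) * g x ∂μ =
        ∑ i ∈ Finset.range n, (A - ∫ x, f (T^[i] x) * g x ∂μ) := by
      rw [Finset.sum_sub_distrib]; simp
    rw [this]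
    calc _ ≤ ∑ i ∈ Finset.range n, |A - ∫ x, f (T^[i] x) * g x ∂μ| :=
          Finset.abs_sum_le_sum_abs _ _
      _ ≤ ∑ i ∈ Finset.range n, n * d := Finset.sum_le_sum hAi
      _ = _ := by simp
  rw [← hAeq]
  have : |n * A| ≤ n * (Real.sqrt (2 * wmDev μ T B n) + n * d) := by
    calc |n * A| = |(n * A - ∫ x, S x * g x ∂μ) + ∫ x, S x * g x ∂μ| := by ring_nf
      _ ≤ _ := abs_add_le _ _
      _ ≤ _ := by linarith
  rw [abs_mul, abs_of_pos hn'] at this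
  exact le_of_mul_le_mul_left this hn'


lemma sum_real_inter {X ι : Type*} [MeasurableSpace X] (μ : Measure X) [IsFiniteMeasure μ]
    [Fintype ι] (f : X → ι) (hf : ∀ y, MeasurableSet (f ⁻¹' {y})) (A : Set X) :
    ∑ y, μ.real (f ⁻¹' {y} ∩ A) = μ.real A := by
  have := sum_measureReal_preimage_singleton (μ := μ.restrict A) Finset.univ (f := f)
    (fun y _ => hf y)
  simp only [Finset.coe_univ, Set.preimage_univ] at this
  rw [measureReal_restrict_apply MeasurableSet.univ, Set.univ_inter] at this
  rw [← this]
  exact Finset.sum_congr rfl fun y _ => (measureReal_restrict_apply (hf y)).symm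

lemma gibbs_pt (p q : ℝ) (hp : 0 ≤ p) (hq : 0 < q) :
    -(p * Real.log p) ≤ p * (-Real.log q) + q - p := by
  rcases hp.eq_or_lt with rfl | hp
  · simp [hq.le]
  · have h := Real.log_le_sub_one_of_pos (div_pos hq hp)
    rw [Real.log_div hq.ne' hp.ne'] at h
    have := mul_le_mul_of_nonneg_left h hp.le
    have e : p * (q / p - 1) = q - p := by field_simp
    rw [e] at this
    linarith

lemma joinEntropy_le {X : Type*} [MeasurableSpace X] (μ : Measure X) [IsProbabilityMeasure μ]
    {n : ℕ} (C : Fin n → Set X) (hC : ∀ i, MeasurableSet (C i))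
    {ι : Type} [Fintype ι] (π : X → ι) (hπ : ∀ j, MeasurableSet (π ⁻¹' {j}))
    (c : ℝ) (hc : 0 < c) (hc2 : c ≤ 1 / 2)
    (h : ∀ i, ∑ j, min (μ.real (π ⁻¹' {j} ∩ C i)) (μ.real (π ⁻¹' {j} \ C i)) ≤ c) :
    joinEntropy μ C * Real.log 2 ≤ Real.log (Fintype.card ι) + n * Real.binEntropy c := by
  classical
  have hX : Nonempty X := by
    by_contra hX
    rw [not_nonempty_iff] at hX
    have := IsProbabilityMeasure.measure_univ (μ := μ)
    rw [Set.univ_eq_empty_iff.mpr hX] at this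
    simp at this
  have hι : Nonempty ι := hX.map π
  set m : ℝ := ((Fintype.card ι : ℕ) : ℝ) with hm
  have hm0 : 0 < m := by rw [hm]; exact_mod_cast Fintype.card_pos
  set name : X → (Fin n → Bool) := fun x i => decide (x ∈ C i) with hname
  have hcell : ∀ s : Fin n → Bool,
      (⋂ i, if s i then C i else (C i)ᶜ) = name ⁻¹' {s} := by
    intro s
    ext x
    simp only [Set.mem_iInter, Set.mem_preimage, Set.mem_singleton_iff, funext_iff, hname]
    refine forall_congr' fun i => ?_
    cases s i <;> simp
  have hcm : ∀ s, MeasurableSet (name ⁻¹' {s}) := by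
    intro s
    rw [← hcell]
    refine MeasurableSet.iInter fun i => ?_
    split_ifs
    exacts [hC i, (hC i).compl]
  set p : (Fin n → Bool) → ι → ℝ := fun s j => μ.real (name ⁻¹' {s} ∩ π ⁻¹' {j}) with hp
  have hp0 : ∀ s j, 0 ≤ p s j := fun s j => measureReal_nonneg
  set P : (Fin n → Bool) → ℝ := fun s => μ.real (name ⁻¹' {s}) with hP
  have hPp : ∀ s, P s = ∑ j, p s j := by
    intro s
    rw [hP]
    simp only
    rw [← sum_real_inter μ π hπ (name ⁻¹' {s})]
    exact Finset.sum_congr rfl fun j _ => by rw [Set.inter_comm]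
  have hP1 : ∑ s, P s = 1 := by
    have := sum_real_inter μ name hcm Set.univ
    simpa using this
  set maj : Fin n → ι → Bool := fun i j =>
    decide (μ.real (π ⁻¹' {j} \ C i) ≤ μ.real (π ⁻¹' {j} ∩ C i)) with hmaj
  set w : Bool → Bool → ℝ := fun a b => if a = b then 1 - c else c with hw
  have hw0 : ∀ a b, 0 < w a b := by
    intro a b; simp only [hw]; split_ifs <;> linarith
  have hws : ∀ b, ∑ a, w a b = 1 := by
    intro b; cases b <;> simp [hw]
  set q : (Fin n → Bool) → ℝ := fun s => ∑ j, m⁻¹ * ∏ i, w (s i) (maj i j) with hq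
  have hterm : ∀ (s : Fin n → Bool) j, 0 < m⁻¹ * ∏ i, w (s i) (maj i j) := fun s j =>
    mul_pos (inv_pos.mpr hm0) (Finset.prod_pos fun i _ => hw0 _ _)
  have hq0 : ∀ s, 0 < q s := fun s =>
    Finset.sum_pos (fun j _ => hterm s j) Finset.univ_nonempty
  have hq1 : ∑ s, q s = 1 := by
    simp only [hq]
    rw [Finset.sum_comm]
    have : ∀ j, ∑ s : Fin n → Bool, m⁻¹ * ∏ i, w (s i) (maj i j) = m⁻¹ := by
      intro j
      rw [← Finset.mul_sum]
      have e := Finset.prod_univ_sum (fun _ : Fin n => (Finset.univ : Finset Bool))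
        (fun i a => w a (maj i j))
      simp only [hws, Finset.prod_const_one, Fintype.piFinset_univ] at e
      rw [← e, mul_one]
    simp_rw [this]
    simp only [Finset.sum_const, Finset.card_univ, nsmul_eq_mul]
    rw [← hm]; exact mul_inv_cancel₀ hm0.ne'
  -- main bound
  have hlogq : ∀ (s : Fin n → Bool) j, -Real.log (q s) ≤ Real.log m + ∑ i, -Real.log (w (s i) (maj i j)) := by
    intro s j
    have h1 : m⁻¹ * ∏ i, w (s i) (maj i j) ≤ q s :=
      Finset.single_le_sum (f := fun j => m⁻¹ * ∏ i, w (s i) (maj i j))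
        (fun j _ => (hterm s j).le) (Finset.mem_univ j)
    have h2 := Real.log_le_log (hterm s j) h1
    rw [Real.log_mul (inv_pos.mpr hm0).ne' (Finset.prod_pos fun i _ => hw0 _ _).ne',
      Real.log_inv, Real.log_prod (fun i _ => (hw0 _ _).ne')] at h2
    rw [Finset.sum_neg_distrib]
    linarith
  have hmis : ∀ i, ∑ j, ∑ s : Fin n → Bool, (if s i = maj i j then 0 else p s j) ≤ c := by
    intro i
    refine le_trans (Finset.sum_le_sum fun j _ => ?_) (h i)
    have e : ∑ s : Fin n → Bool, (if s i = maj i j then 0 else p s j) =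
        μ.real (π ⁻¹' {j} ∩ {x | name x i ≠ maj i j}) := by
      rw [← sum_real_inter μ name hcm]
      refine Finset.sum_congr rfl fun s _ => ?_
      split_ifs with hs
      · symm
        have : name ⁻¹' {s} ∩ (π ⁻¹' {j} ∩ {x | name x i ≠ maj i j}) = ∅ := by
          ext x
          simp only [Set.mem_inter_iff, Set.mem_preimage, Set.mem_singleton_iff, Set.mem_ofPred_eq,
            Set.mem_empty_iff_false, iff_false, not_and]
          intro h1 _ h3
          exact h3 (by rw [h1, hs])
        rw [this]; simp
      · simp only [hp]
        congr 1
        ext x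
        simp only [Set.mem_inter_iff, Set.mem_preimage, Set.mem_singleton_iff, Set.mem_ofPred_eq]
        constructor
        · rintro ⟨h1, h2⟩; exact ⟨h1, h2, by rw [h1]; exact hs⟩
        · rintro ⟨h1, h2, _⟩; exact ⟨h1, h2⟩
    rw [e]
    by_cases hle : μ.real (π ⁻¹' {j} \ C i) ≤ μ.real (π ⁻¹' {j} ∩ C i)
    · rw [min_eq_right hle]
      apply le_of_eq; congr 1
      ext x; simp [hmaj, hname, hle]
    · rw [min_eq_left (not_le.mp hle).le]
      apply le_of_eq; congr 1
      ext x; simp [hmaj, hname, hle]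
  have htot : ∑ j, ∑ s, p s j = 1 := by
    rw [Finset.sum_comm, ← hP1]
    exact Finset.sum_congr rfl fun s _ => (hPp s).symm
  have hi : ∀ i, ∑ s : Fin n → Bool, ∑ j, p s j * (-Real.log (w (s i) (maj i j))) ≤ Real.binEntropy c := by
    intro i
    rw [Finset.sum_comm]
    have e : ∀ j (s : Fin n → Bool), p s j * (-Real.log (w (s i) (maj i j))) =
        p s j * (-Real.log (1 - c)) +
        (if s i = maj i j then 0 else p s j) * (Real.log (1 - c) - Real.log c) := by
      intro j s; simp only [hw]; split_ifs <;> ring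
    simp_rw [e, Finset.sum_add_distrib, ← Finset.sum_mul]
    rw [htot, Real.binEntropy]
    have hl : 0 ≤ Real.log (1 - c) - Real.log c := by
      have := Real.log_le_log hc (show c ≤ 1 - c by linarith)
      linarith
    have := mul_le_mul_of_nonneg_right (hmis i) hl
    rw [Real.log_inv, Real.log_inv]
    linarith
  have hl2 : Real.log 2 ≠ 0 := (Real.log_pos (by norm_num)).ne'
  have hje : joinEntropy μ C * Real.log 2 = ∑ s, -(P s * Real.log (P s)) := by
    unfold joinEntropy
    rw [Finset.sum_mul]
    refine Finset.sum_congr rfl fun s _ => ?_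
    rw [hcell s]
    simp only [hP, Measure.real, Real.logb]
    field_simp
  rw [hje]
  calc ∑ s, -(P s * Real.log (P s))
      ≤ ∑ s, (P s * (-Real.log (q s)) + q s - P s) :=
        Finset.sum_le_sum fun s _ => gibbs_pt _ _ measureReal_nonneg (hq0 s)
    _ = ∑ s, P s * (-Real.log (q s)) := by
        rw [Finset.sum_sub_distrib, Finset.sum_add_distrib, hq1, hP1]; ring
    _ ≤ ∑ s, ∑ j, (p s j * Real.log m + ∑ i, p s j * (-Real.log (w (s i) (maj i j)))) := by
        refine Finset.sum_le_sum fun s _ => ?_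
        rw [hPp, Finset.sum_mul]
        refine Finset.sum_le_sum fun j _ => ?_
        rw [← Finset.mul_sum, ← mul_add]
        exact mul_le_mul_of_nonneg_left (hlogq s j) (hp0 s j)
    _ = Real.log m + ∑ i, ∑ s : Fin n → Bool, ∑ j, p s j * (-Real.log (w (s i) (maj i j))) := by
        simp_rw [Finset.sum_add_distrib, ← Finset.sum_mul]
        rw [Finset.sum_comm (s := Finset.univ) (t := Finset.univ) (f := fun s j => p s j), htot,
          one_mul]
        congr 1
        symm
        rw [Finset.sum_comm]
        refine Finset.sum_congr rfl fun s _ => ?_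
        rw [Finset.sum_comm]
    _ ≤ Real.log m + ∑ i : Fin n, Real.binEntropy c := by
        gcongr with i _
        exact hi i
    _ = _ := by simp

lemma exists_seq_of_pos {X : Type*} [MeasurableSpace X] (μ : Measure X) 
    (𝒞 : Set (Set X)) (hent : 0 < famEntropy μ 𝒞) :
    ∃ f : ℕ → Set X, (∀ i, f i ∈ 𝒞) ∧ ∃ a > 0, ∀ᶠ n : ℕ in atTop,
      a ≤ joinEntropy μ (fun i : Fin n => f i) / n := by
  unfold famEntropy at hent
  by_cases hne : Nonempty {f : ℕ → Set X // ∀ i, f i ∈ 𝒞}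
  · obtain ⟨S, hS⟩ := exists_lt_of_lt_ciSup hent
    refine ⟨S.1, S.2, ?_⟩
    rw [Filter.liminf_eq] at hS
    by_cases hne2 : {a : ℝ | ∀ᶠ n : ℕ in atTop,
        a ≤ joinEntropy μ (fun i : Fin n => S.1 i) / n}.Nonempty
    · obtain ⟨a, ha, h0⟩ := exists_lt_of_lt_csSup hne2 hS
      exact ⟨a, h0, ha⟩
    · rw [Set.not_nonempty_iff_eq_empty.mp hne2] at hS
      simp at hS
  · rw [not_nonempty_iff] at hne
    rw [Real.iSup_of_isEmpty] at hent
    exact absurd hent (lt_irrefl _)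

lemma entropy_partition {X : Type*} [MeasurableSpace X] (μ : Measure X) [IsProbabilityMeasure μ]
    (𝒞 : Set (Set X)) (h𝒞 : ∀ C ∈ 𝒞, MeasurableSet C) (hent : 0 < famEntropy μ 𝒞) :
    ∃ c > 0, ∀ (ι : Type) [Fintype ι] (π : X → ι), (∀ j, MeasurableSet (π ⁻¹' {j})) →
      ∃ C ∈ 𝒞, c ≤ ∑ j, min (μ.real (π ⁻¹' {j} ∩ C)) (μ.real (π ⁻¹' {j} \ C)) := by
  obtain ⟨f, hf, a, ha, hev⟩ := exists_seq_of_pos μ 𝒞 hent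
  have hl2 : 0 < Real.log 2 := Real.log_pos (by norm_num)
  have hcont : Tendsto Real.binEntropy (nhds 0) (nhds 0) := by
    have := Real.binEntropy_continuous.tendsto 0
    simpa using this
  have h1 : ∀ᶠ c in nhdsWithin (0:ℝ) (Set.Ioi 0), Real.binEntropy c < a * Real.log 2 / 2 :=
    (hcont.eventually_lt_const (by positivity)).filter_mono nhdsWithin_le_nhds
  have h2 : ∀ᶠ c in nhdsWithin (0:ℝ) (Set.Ioi 0), c < 1 / 2 :=
    (eventually_lt_nhds (by norm_num)).filter_mono nhdsWithin_le_nhds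
  obtain ⟨c, ⟨hc1, hc2⟩, hc0⟩ := ((h1.and h2).and self_mem_nhdsWithin).exists
  refine ⟨c, hc0, fun ι _ π hπ => ?_⟩
  by_contra hcon
  push Not at hcon
  have hb : ∀ n : ℕ, joinEntropy μ (fun i : Fin n => f i) * Real.log 2 ≤
      Real.log (Fintype.card ι) + n * Real.binEntropy c := fun n =>
    joinEntropy_le μ _ (fun i => h𝒞 _ (hf i)) π hπ c hc0 hc2.le (fun i => (hcon _ (hf i)).le)
  have h3 : ∀ᶠ n : ℕ in atTop, Real.log (Fintype.card ι) < n * (a * Real.log 2 / 2) := by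
    have : Tendsto (fun n : ℕ => (n:ℝ) * (a * Real.log 2 / 2)) atTop atTop :=
      tendsto_natCast_atTop_atTop.atTop_mul_const (by positivity)
    exact this.eventually_gt_atTop _
  obtain ⟨n, ⟨hn1, hn2⟩, hn3⟩ := ((hev.and h3).and (eventually_gt_atTop 0)).exists
  have hn' : (0:ℝ) < n := by exact_mod_cast hn3
  rw [le_div_iff₀ hn'] at hn1
  have h4 := hb n
  have h5 := mul_le_mul_of_nonneg_right hn1 hl2.le
  have h6 := mul_lt_mul_of_pos_left hc1 hn'
  nlinarith


def WMix {X : Type*} [MeasurableSpace X] (μ : Measure X) (T : X → X) : Prop :=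
  ∀ A B : Set X, MeasurableSet A → MeasurableSet B →
      Tendsto (fun n : ℕ =>
          (∑ i ∈ Finset.range n,
            |(μ (A ∩ (T^[i]) ⁻¹' B)).toReal - (μ A).toReal * (μ B).toReal|) / n)
        atTop (nhds 0)

lemma WMix.exists_near {X : Type*} [MeasurableSpace X] {μ : Measure X} {T : X → X}
    (h : WMix μ T) {A B : Set X} (hA : MeasurableSet A) (hB : MeasurableSet B)
    {ε : ℝ} (hε : 0 < ε) :
    ∃ k, |μ.real (A ∩ T^[k] ⁻¹' B) - μ.real A * μ.real B| < ε := by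
  by_contra hcon
  push Not at hcon
  obtain ⟨n, h1, h2⟩ := (((h A B hA hB).eventually_lt_const hε).and
    (eventually_gt_atTop 0)).exists
  have hn : (0:ℝ) < n := by exact_mod_cast h2
  rw [div_lt_iff₀ hn] at h1
  have : ∑ i ∈ Finset.range n, ε ≤ ∑ i ∈ Finset.range n,
            |(μ (A ∩ (T^[i]) ⁻¹' B)).toReal - (μ A).toReal * (μ B).toReal| :=
    Finset.sum_le_sum fun i _ => hcon i
  simp at this
  linarith

lemma WMix.small_sets {X : Type*} [MeasurableSpace X] {μ : Measure X} [IsProbabilityMeasure μ]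
    {T : X → X} (hT : MeasurePreserving T μ μ)
    (h : WMix μ T) {A : Set X} (hA : MeasurableSet A) (h0 : 0 < μ.real A) (h1 : μ.real A < 1)
    {δ : ℝ} (hδ : 0 < δ) : ∃ F, MeasurableSet F ∧ 0 < μ.real F ∧ μ.real F < δ := by
  set a := μ.real A with ha
  have key : ∀ m : ℕ, ∃ F, MeasurableSet F ∧ 0 < μ.real F ∧ μ.real F ≤ a ∧
      μ.real F ≤ ((1 + a) / 2) ^ m := by
    intro m
    induction m with
    | zero => exact ⟨A, hA, h0, le_rfl, by simpa using h1.le⟩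
    | succ m ih =>
      obtain ⟨F, hF, hF0, hFa, hFm⟩ := ih
      set t := μ.real F with ht
      have hε : 0 < min (t ^ 2) (t * (1 - a) / 2) := by
        apply lt_min
        · positivity
        · have : 0 < 1 - a := by linarith
          positivity
      obtain ⟨k, hk⟩ := h.exists_near hF hF hε
      rw [← ht, abs_lt] at hk
      have e1 := min_le_left (t ^ 2) (t * (1 - a) / 2)
      have e2 := min_le_right (t ^ 2) (t * (1 - a) / 2)
      refine ⟨F ∩ T^[k] ⁻¹' F, hF.inter ((hT.iterate k).measurable hF), by nlinarith, ?_, ?_⟩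
      · exact (measureReal_mono Set.inter_subset_left).trans hFa
      · have : μ.real (F ∩ T^[k] ⁻¹' F) ≤ t * ((1 + a) / 2) := by nlinarith
        rw [pow_succ]
        refine this.trans ?_
        apply mul_le_mul_of_nonneg_right hFm; linarith
  have hlim := tendsto_pow_atTop_nhds_zero_of_lt_one (show 0 ≤ (1 + a) / 2 by linarith)
    (show (1 + a) / 2 < 1 by linarith)
  obtain ⟨m, hm⟩ := (hlim.eventually_lt_const hδ).exists
  obtain ⟨F, hF, hF0, _, hFm⟩ := key m
  exact ⟨F, hF, hF0, hFm.trans_lt hm⟩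

lemma WMix.exists_inv {X : Type*} [MeasurableSpace X] {μ : Measure X} [IsProbabilityMeasure μ]
    {T : X → X} (hT : MeasurePreserving T μ μ)
    (h : WMix μ T) {A : Set X} (hA : MeasurableSet A) (h0 : 0 < μ.real A) (h1 : μ.real A < 1)
    {δ : ℝ} (hδ : 0 < δ) : ∃ E, MeasurableSet E ∧ 1 / 2 ≤ μ.real E ∧ μ.real E ≤ 1 / 2 + δ ∧
      μ.real (T ⁻¹' E \ E) + μ.real (E \ T ⁻¹' E) ≤ 2 * δ := by
  obtain ⟨F, hF, hF0, hFδ⟩ := h.small_sets hT hA h0 h1 hδ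
  have hFi : ∀ i, MeasurableSet (T^[i] ⁻¹' F) := fun i => (hT.iterate i).measurable hF
  have hFr : ∀ i, μ.real (T^[i] ⁻¹' F) = μ.real F := fun i =>
    (hT.iterate i).measureReal_preimage hF.nullMeasurableSet
  set E : ℕ → Set X := fun K => ⋃ i ∈ Finset.range K, T^[i] ⁻¹' F with hE
  have hmem : ∀ K x, x ∈ E K ↔ ∃ i < K, T^[i] x ∈ F := by
    intro K x; simp [hE]
  have hEm : ∀ K, MeasurableSet (E K) := fun K =>
    Finset.measurableSet_biUnion _ fun i _ => hFi i
  have hmono : Monotone E := by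
    intro K L hKL x hx
    rw [hmem] at *
    obtain ⟨i, hi, hx⟩ := hx
    exact ⟨i, by omega, hx⟩
  have hU : μ.real (⋃ K, E K) = 1 := by
    have hUm : MeasurableSet (⋃ K, E K) := MeasurableSet.iUnion hEm
    by_contra hne
    have hc : 0 < μ.real (⋃ K, E K)ᶜ := by
      rw [probReal_compl_eq_one_sub hUm]
      have : μ.real (⋃ K, E K) ≤ 1 := measureReal_le_one
      have := lt_of_le_of_ne this hne
      linarith
    obtain ⟨k, hk⟩ := h.exists_near hUm.compl hF (mul_pos hc hF0)
    have : (⋃ K, E K)ᶜ ∩ T^[k] ⁻¹' F = ∅ := by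
      ext x
      simp only [Set.mem_inter_iff, Set.mem_compl_iff, Set.mem_iUnion, Set.mem_preimage,
        Set.mem_empty_iff_false, iff_false, not_and, not_exists]
      intro h1 h2
      exact h1 (k+1) ((hmem _ _).2 ⟨k, by omega, h2⟩)
    rw [this] at hk
    simp only [measureReal_empty, zero_sub, abs_neg] at hk
    rw [abs_of_pos (mul_pos hc hF0)] at hk
    exact lt_irrefl _ hk
  have hlim : Tendsto (fun K => μ.real (E K)) atTop (nhds 1) := by
    rw [← hU]
    exact (ENNReal.tendsto_toReal (measure_ne_top _ _)).comp (tendsto_measure_iUnion_atTop hmono)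
  have hex : ∃ K, 1 / 2 ≤ μ.real (E K) :=
    ((hlim.eventually_const_lt (show (1:ℝ)/2 < 1 by norm_num)).exists).imp fun K hK => hK.le
  classical
  set K := Nat.find hex with hK
  have hK1 : 1 / 2 ≤ μ.real (E K) := Nat.find_spec hex
  have hK0 : K ≠ 0 := by
    intro h0
    rw [h0] at hK1
    simp [hE] at hK1
    norm_num at hK1
  obtain ⟨L, hL⟩ := Nat.exists_eq_succ_of_ne_zero hK0
  have hL1 : μ.real (E L) < 1 / 2 := by
    have := Nat.find_min hex (m := L) (by omega)
    exact not_le.mp this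
  refine ⟨E K, hEm K, hK1, ?_, ?_⟩
  · have hsub : E K ⊆ E L ∪ T^[L] ⁻¹' F := by
      intro x hx
      rw [hmem] at hx
      obtain ⟨i, hi, hx⟩ := hx
      by_cases hiL : i < L
      · exact Or.inl ((hmem _ _).2 ⟨i, hiL, hx⟩)
      · have : i = L := by omega
        subst this; exact Or.inr hx
    have := (measureReal_mono (μ := μ) hsub).trans (measureReal_union_le _ _)
    rw [hFr] at this
    linarith
  · have e1 : T ⁻¹' E K \ E K ⊆ T^[K] ⁻¹' F := by
      rintro x ⟨h1, h2⟩
      rw [Set.mem_preimage, hmem] at h1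
      obtain ⟨i, hi, hx⟩ := h1
      by_cases hiL : i + 1 < K
      · exact absurd ((hmem _ _).2 ⟨i+1, hiL, by rwa [Function.iterate_succ_apply]⟩) h2
      · have : K = i + 1 := by omega
        rw [this, Set.mem_preimage, Function.iterate_succ_apply]; exact hx
    have e2 : E K \ T ⁻¹' E K ⊆ T^[0] ⁻¹' F := by
      rintro x ⟨h1, h2⟩
      rw [hmem] at h1
      obtain ⟨i, hi, hx⟩ := h1
      rcases i with _ | i
      · exact hx
      · exfalso; apply h2
        rw [Set.mem_preimage, hmem]
        exact ⟨i, by omega, by rwa [Function.iterate_succ_apply] at hx⟩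
    have f1 := measureReal_mono (μ := μ) e1
    have f2 := measureReal_mono (μ := μ) e2
    rw [hFr] at f1 f2
    linarith

lemma exists_swapMPE {X : Type*} [MeasurableSpace X] {μ : Measure X} [IsProbabilityMeasure μ]
    (S : X ≃ᵐ X) (hS : MeasurePreserving S μ μ) {W : Set X} (hW : MeasurableSet W)
    (hd : ∀ x ∈ W, S x ∉ W) :
    ∃ σ : MPE μ, (∀ x ∈ W, σ.1 x = S x) ∧ (∀ x, S.symm x ∈ W → σ.1 x = S.symm x) ∧
      (∀ x, x ∉ W → S.symm x ∉ W → σ.1 x = x) ∧ (∀ x, σ.1.symm x = σ.1 x) := by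
  classical
  set V : Set X := S.symm ⁻¹' W with hV
  have hVm : MeasurableSet V := S.symm.measurable hW
  set f : X → X := fun x => if x ∈ W then S x else if x ∈ V then S.symm x else x with hf
  have hfm : Measurable f :=
    Measurable.ite hW S.measurable (Measurable.ite hVm S.symm.measurable measurable_id)
  have f1 : ∀ x ∈ W, f x = S x := fun x hx => by simp [hf, hx]
  have hVW : ∀ x ∈ V, x ∉ W := by
    intro x hx hxW
    have := hd _ hx
    simp only [MeasurableEquiv.apply_symm_apply] at this
    exact this hxW
  have f2 : ∀ x ∈ V, f x = S.symm x := fun x hx => by simp [hf, hx, hVW x hx]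
  have f3 : ∀ x, x ∉ W → x ∉ V → f x = x := fun x h1 h2 => by simp [hf, h1, h2]
  have hWV : ∀ x ∈ W, S x ∈ V := fun x hx => by simp [hV, hx]
  have hinv : ∀ x, f (f x) = x := by
    intro x
    by_cases h1 : x ∈ W
    · rw [f1 x h1, f2 _ (hWV x h1)]; simp
    · by_cases h2 : x ∈ V
      · rw [f2 x h2, f1 _ h2]; simp
      · rw [f3 x h1 h2, f3 x h1 h2]
  let e : X ≃ᵐ X := ⟨⟨f, f, hinv, hinv⟩, hfm, hfm⟩
  have hSs : MeasurePreserving S.symm μ μ := hS.symm S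
  have hmp : MeasurePreserving f μ μ := by
    refine ⟨hfm, ?_⟩
    ext A hA
    rw [Measure.map_apply hfm hA]
    have hfA : MeasurableSet (f ⁻¹' A) := hfm hA
    have d1 : ∀ B : Set X, MeasurableSet B → 
        μ B = μ (B ∩ W) + (μ (B ∩ V) + μ ((B \ W) \ V)) := by
      intro B hB
      rw [← measure_inter_add_sdiff B hW, ← measure_inter_add_sdiff (B \ W) hVm]
      congr 3
      ext x
      simp only [Set.mem_inter_iff, Set.mem_sdiff]
      constructor
      · rintro ⟨⟨h1, _⟩, h2⟩; exact ⟨h1, h2⟩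
      · rintro ⟨h1, h2⟩; exact ⟨⟨h1, hVW x h2⟩, h2⟩
    rw [d1 _ hfA, d1 _ hA]
    have g1 : μ (f ⁻¹' A ∩ W) = μ (A ∩ V) := by
      rw [← hS.measure_preimage (hA.inter hVm).nullMeasurableSet]
      congr 1; ext x
      simp only [Set.mem_inter_iff, Set.mem_preimage]
      constructor
      · rintro ⟨h1, h2⟩; rw [f1 x h2] at h1; exact ⟨h1, hWV x h2⟩
      · rintro ⟨h1, h2⟩
        have : x ∈ W := by simpa [hV] using h2
        exact ⟨by rw [f1 x this]; exact h1, this⟩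
    have g2 : μ (f ⁻¹' A ∩ V) = μ (A ∩ W) := by
      rw [← hSs.measure_preimage (hA.inter hW).nullMeasurableSet]
      congr 1; ext x
      simp only [Set.mem_inter_iff, Set.mem_preimage]
      constructor
      · rintro ⟨h1, h2⟩; rw [f2 x h2] at h1; exact ⟨h1, h2⟩
      · rintro ⟨h1, h2⟩
        exact ⟨by rw [f2 x h2]; exact h1, h2⟩
    have g3 : (f ⁻¹' A \ W) \ V = (A \ W) \ V := by
      ext x
      simp only [Set.mem_sdiff, Set.mem_preimage]
      constructor
      · rintro ⟨⟨h1, h2⟩, h3⟩; rw [f3 x h2 h3] at h1; exact ⟨⟨h1, h2⟩, h3⟩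
      · rintro ⟨⟨h1, h2⟩, h3⟩; rw [f3 x h2 h3]; exact ⟨⟨h1, h2⟩, h3⟩
    rw [g1, g2, g3]
    ring
  exact ⟨⟨e, hmp⟩, f1, fun x hx => f2 x hx, fun x h1 h2 => f3 x h1 h2, fun x => rfl⟩

lemma exists_iter {X : Type*} [MeasurableSpace X] (T : X ≃ᵐ X) (k : ℕ) :
    ∃ S : X ≃ᵐ X, ∀ x, S x = T^[k] x := by
  induction k with
  | zero => exact ⟨MeasurableEquiv.refl X, fun x => rfl⟩
  | succ k ih =>
    obtain ⟨S, hS⟩ := ih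
    exact ⟨T.trans S, fun x => by simp [hS]⟩

lemma WMix.exists_opt {X : Type*} [MeasurableSpace X] {μ : Measure X} [IsProbabilityMeasure μ]
    (T : X ≃ᵐ X) (hT : MeasurePreserving T μ μ) (h : WMix μ T)
    {ι : Type} (π : X → ι) (hπ : ∀ j, MeasurableSet (π ⁻¹' {j}))
    {C E : Set X} (hC : MeasurableSet C) (hE : MeasurableSet E) {ε : ℝ} (hε : 0 < ε) :
    ∃ η : MPE μ, (∀ x, π (η.1 x) = π x) ∧ ∀ j,
      μ.real ((π ⁻¹' {j} ∩ η.1.symm ⁻¹' C) \ E) ≤ ε ∨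
      μ.real ((π ⁻¹' {j} ∩ E) \ η.1.symm ⁻¹' C) ≤ ε := by
  set Vals : Set ℝ := {v | ∃ η : MPE μ, (∀ x, π (η.1 x) = π x) ∧
    v = μ.real (η.1.symm ⁻¹' C ∩ E)} with hVals
  have hne : Vals.Nonempty :=
    ⟨_, ⟨MeasurableEquiv.refl X, MeasurePreserving.id μ⟩, fun x => rfl, rfl⟩
  have hbdd : BddAbove Vals := ⟨1, by rintro v ⟨η, _, rfl⟩; exact measureReal_le_one⟩
  obtain ⟨v, ⟨η, hη, rfl⟩, hv⟩ := exists_lt_of_lt_csSup hne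
    (show sSup Vals - ε ^ 2 / 2 < sSup Vals by have := sq_pos_of_pos hε; linarith)
  refine ⟨η, hη, fun j => ?_⟩
  by_contra hcon
  push Not at hcon
  obtain ⟨hu, hv'⟩ := hcon
  set D := η.1.symm ⁻¹' C with hD
  have hDm : MeasurableSet D := η.1.symm.measurable hC
  set U := (π ⁻¹' {j} ∩ D) \ E with hU
  set V := (π ⁻¹' {j} ∩ E) \ D with hV
  have hUm : MeasurableSet U := ((hπ j).inter hDm).diff hE
  have hVm : MeasurableSet V := ((hπ j).inter hE).diff hDm
  obtain ⟨k, hk⟩ := h.exists_near hUm hVm (show 0 < ε ^ 2 / 2 by positivity)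
  set W := U ∩ T^[k] ⁻¹' V with hW
  have hWm : MeasurableSet W := hUm.inter ((hT.iterate k).measurable hVm)
  have hWr : ε ^ 2 / 2 < μ.real W := by
    rw [abs_lt] at hk
    nlinarith
  obtain ⟨S, hS⟩ := exists_iter T k
  have hSmp : MeasurePreserving S μ μ := by
    have := hT.iterate k
    have e : (S : X → X) = T^[k] := funext hS
    rw [e]; exact this
  have hSV : ∀ x ∈ W, S x ∈ V := fun x hx => by rw [hS]; exact hx.2
  obtain ⟨σ, s1, s2, s3, s4⟩ := exists_swapMPE S hSmp hWm (fun x hx hx2 =>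
    (hSV x hx).2 hx2.1.1.2)
  have hSV' : ∀ x, S.symm x ∈ W → x ∈ V := fun x hx => by simpa using hSV _ hx
  have hσπ : ∀ x, π (σ.1 x) = π x := by
    intro x
    by_cases h1 : x ∈ W
    · rw [s1 x h1]
      have a1 : π (S x) = j := (hSV x h1).1.1
      have a2 : π x = j := h1.1.1.1
      rw [a1, a2]
    · by_cases h2 : S.symm x ∈ W
      · rw [s2 x h2]
        have a1 : π x = j := (hSV' x h2).1.1
        have a2 : π (S.symm x) = j := h2.1.1.1
        rw [a1, a2]
      · rw [s3 x h1 h2]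
  have hmem : μ.real ((η.1.trans σ.1).symm ⁻¹' C ∩ E) ∈ Vals :=
    ⟨⟨η.1.trans σ.1, σ.2.comp η.2⟩, fun x => by simp [hσπ, hη], rfl⟩
  have hle := le_csSup hbdd hmem
  have hsub : (D ∩ E) ∪ S.symm ⁻¹' W ⊆ (η.1.trans σ.1).symm ⁻¹' C ∩ E := by
    have hm : ∀ x, x ∈ (η.1.trans σ.1).symm ⁻¹' C ↔ σ.1 x ∈ D := by
      intro x
      rw [← s4]; rfl
    rintro x (⟨h1, h2⟩ | h1)
    · refine ⟨?_, h2⟩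
      rw [hm, s3 x (fun hx => hx.1.2 h2) (fun hx => (hSV' x hx).2 h1)]
      exact h1
    · have h1' : S.symm x ∈ W := h1
      refine ⟨?_, (hSV' x h1).1.2⟩
      rw [hm, s2 x h1]
      exact h1'.1.1.2
  have hdis : Disjoint (D ∩ E) (S.symm ⁻¹' W) := by
    rw [Set.disjoint_left]
    rintro x ⟨h1, _⟩ h2
    exact (hSV' x h2).2 h1
  have h5 := measureReal_mono (μ := μ) hsub
  rw [measureReal_union hdis (S.symm.measurable hWm),
    (hSmp.symm S).measureReal_preimage hWm.nullMeasurableSet] at h5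
  linarith


lemma mp_image_real {X : Type*} [MeasurableSpace X] {μ : Measure X} 
    (φ : MPE μ) {A : Set X} (hA : MeasurableSet A) : μ.real (φ.1.symm ⁻¹' A) = μ.real A :=
  (φ.2.symm φ.1).measureReal_preimage hA.nullMeasurableSet

lemma WMix.step {X : Type*} [MeasurableSpace X] {μ : Measure X} [IsProbabilityMeasure μ]
    (T : X ≃ᵐ X) (hT : MeasurePreserving T μ μ) (h : WMix μ T)
    {ι : Type} [Fintype ι] (π : X → ι) (hπ : ∀ j, MeasurableSet (π ⁻¹' {j}))
    {C : Set X} (hC : MeasurableSet C) {c : ℝ} (hc : 0 < c)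
    (hcC : c ≤ ∑ j, min (μ.real (π ⁻¹' {j} ∩ C)) (μ.real (π ⁻¹' {j} \ C)))
    {A : Set X} (hA : MeasurableSet A) (h0 : 0 < μ.real A) (h1 : μ.real A < 1) (N : ℕ) :
    ∃ η : MPE μ, (∀ x, π (η.1 x) = π x) ∧ ∃ n ≥ N,
      c ^ 2 / 200 < wmDev μ T (η.1.symm ⁻¹' C) n := by
  classical
  have hι : Nonempty ι := by
    by_contra hι
    rw [not_nonempty_iff] at hι
    simp at hcC
    linarith
  set m : ℝ := ((Fintype.card ι : ℕ) : ℝ) with hm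
  have hm0 : 0 < m := by rw [hm]; exact_mod_cast Fintype.card_pos
  set ε := c / (16 * m) with hε
  have hε0 : 0 < ε := by positivity
  have hev : ∀ᶠ M in atTop, ∀ j, wmDev μ T (π ⁻¹' {j}) M < ε ^ 2 / 8 := by
    rw [eventually_all]
    intro j
    have := (h _ _ (hπ j) (hπ j)).eventually_lt_const (show 0 < ε ^ 2 / 8 by positivity)
    filter_upwards [this] with M hM
    unfold wmDev
    simpa only [sq] using hM
  obtain ⟨M, hM, hM0⟩ := (hev.and (eventually_gt_atTop 0)).exists
  set n := N + 1 with hn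
  have hn0 : (0:ℝ) < n := by rw [hn]; positivity
  set δ := min (ε / (2 * (2 * M + 1))) (c / (16 * n)) with hδ
  have hδ0 : 0 < δ := by
    apply lt_min <;> positivity
  have hδ1 : (2 * M + 1) * δ ≤ ε / 2 := by
    have := min_le_left (ε / (2 * (2 * M + 1))) (c / (16 * n))
    rw [← hδ, le_div_iff₀ (by positivity)] at this
    linarith
  have hδ2 : n * δ ≤ c / 16 := by
    have := min_le_right (ε / (2 * (2 * M + 1))) (c / (16 * n))
    rw [← hδ, le_div_iff₀ (by positivity)] at this
    linarith
  have hn1 : (1:ℝ) ≤ n := by rw [hn]; push_cast; have : (0:ℝ) ≤ N := by positivity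
                             linarith
  have hδ3 : δ ≤ c / 16 := by nlinarith
  obtain ⟨E, hE, hE1, hE2, hE3⟩ := h.exists_inv hT hA h0 h1 hδ0
  obtain ⟨η, hη, hopt⟩ := h.exists_opt T hT π hπ hC hE hε0
  refine ⟨η, hη, n, by omega, ?_⟩
  set B := η.1.symm ⁻¹' C with hB
  have hBm : MeasurableSet B := η.1.symm.measurable hC
  have hηs : ∀ x, π (η.1.symm x) = π x := fun x => by
    have := hη (η.1.symm x); simpa using this.symm
  have hcj : ∀ j, μ.real (π ⁻¹' {j} ∩ B) = μ.real (π ⁻¹' {j} ∩ C) := by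
    intro j
    rw [← mp_image_real η ((hπ j).inter hC)]
    congr 1; ext x
    simp [hB, hηs]
  have hRE : ∀ j, μ.real (π ⁻¹' {j}) / 2 - ε ≤ μ.real (π ⁻¹' {j} ∩ E) := by
    intro j
    have h2 := corr_bound μ T hT (hπ j) hE M hM0 _ hE3
    have h3 : Real.sqrt (2 * wmDev μ T (π ⁻¹' {j}) M) ≤ ε / 2 := by
      rw [Real.sqrt_le_left (by positivity)]
      have := hM j
      nlinarith
    rw [abs_le] at h2
    have h4 : μ.real (π ⁻¹' {j}) * (1/2) ≤ μ.real (π ⁻¹' {j}) * μ.real E :=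
      mul_le_mul_of_nonneg_left hE1 measureReal_nonneg
    nlinarith [h2.1]
  have hgain : ∀ j, min (μ.real (π ⁻¹' {j} ∩ C)) (μ.real (π ⁻¹' {j} \ C)) / 2 - 2 * ε ≤
      μ.real (π ⁻¹' {j} ∩ (B ∩ E)) - μ.real (π ⁻¹' {j} ∩ B) / 2 := by
    intro j
    have a1 := measureReal_inter_add_sdiff (μ := μ) (s := π ⁻¹' {j}) hC
    have a2 := measureReal_inter_add_sdiff (μ := μ) (s := π ⁻¹' {j} ∩ B) hE
    have a3 := measureReal_inter_add_sdiff (μ := μ) (s := π ⁻¹' {j} ∩ E) hBm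
    have a4 : π ⁻¹' {j} ∩ B ∩ E = π ⁻¹' {j} ∩ (B ∩ E) := Set.inter_assoc _ _ _
    have a5 : π ⁻¹' {j} ∩ E ∩ B = π ⁻¹' {j} ∩ (B ∩ E) := by
      rw [Set.inter_assoc, Set.inter_comm E B]
    rw [a4] at a2
    rw [a5] at a3
    have a6 := hRE j
    have a7 := hcj j
    have m1 := min_le_left (μ.real (π ⁻¹' {j} ∩ C)) (μ.real (π ⁻¹' {j} \ C))
    have m2 := min_le_right (μ.real (π ⁻¹' {j} ∩ C)) (μ.real (π ⁻¹' {j} \ C))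
    rcases hopt j with ho | ho <;> linarith
  have hsum := Finset.sum_le_sum (fun j (_ : j ∈ Finset.univ) => hgain j)
  rw [Finset.sum_sub_distrib, Finset.sum_sub_distrib, ← Finset.sum_div, ← Finset.sum_div,
    sum_real_inter μ π hπ, sum_real_inter μ π hπ] at hsum
  simp only [Finset.sum_const, Finset.card_univ, nsmul_eq_mul] at hsum
  rw [← hm] at hsum
  have hmε : m * (2 * ε) = c / 8 := by rw [hε]; field_simp; norm_num
  have hBE : μ.real B * μ.real E ≤ μ.real B / 2 + δ := by
    have : μ.real B ≤ 1 := measureReal_le_one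
    have b0 : 0 ≤ μ.real B := measureReal_nonneg
    nlinarith
  have hfin := corr_bound μ T hT hBm hE n (by omega) _ hE3
  have hfin2 := (le_abs_self _).trans hfin
  have hs : c / 8 ≤ Real.sqrt (2 * wmDev μ T B n) := by linarith
  rw [Real.le_sqrt' (by positivity)] at hs
  nlinarith [sq_pos_of_pos hc]

lemma conj_iter {X : Type*} [MeasurableSpace X] {μ : Measure X} (T : X ≃ᵐ X) (φ : MPE μ)
    (i : ℕ) (x : X) : (MPE.conj T φ)^[i] x = φ.1.symm (T^[i] (φ.1 x)) := by
  induction i with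
  | zero => simp
  | succ i ih => rw [Function.iterate_succ_apply', ih, Function.iterate_succ_apply', MPE.conj]; simp

lemma conj_measure {X : Type*} [MeasurableSpace X] {μ : Measure X} (T : X ≃ᵐ X)
    (φ : MPE μ) {A B : Set X} (hA : MeasurableSet A) (hB : MeasurableSet B) (i : ℕ) :
    μ (A ∩ (MPE.conj T φ)^[i] ⁻¹' B) = μ (φ.1.symm ⁻¹' A ∩ T^[i] ⁻¹' (φ.1.symm ⁻¹' B)) := by
  have hTi : Measurable T^[i] := T.measurable.iterate i
  rw [← φ.2.measure_preimage (((φ.1.symm.measurable hA).inter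
    (hTi (φ.1.symm.measurable hB)))).nullMeasurableSet]
  congr 1; ext x
  simp [conj_iter]

lemma conj_dev {X : Type*} [MeasurableSpace X] {μ : Measure X} (T : X ≃ᵐ X)
    (φ : MPE μ) {A : Set X} (hA : MeasurableSet A) (n : ℕ) :
    wmDev μ (MPE.conj T φ) A n = wmDev μ T (φ.1.symm ⁻¹' A) n := by
  unfold wmDev
  simp_rw [conj_measure T φ hA hA]
  have := mp_image_real φ hA
  simp only [Measure.real] at this
  rw [this]

lemma WMix.conj {X : Type*} [MeasurableSpace X] {μ : Measure X} {T : X ≃ᵐ X}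
    (h : WMix μ T) (φ : MPE μ) : WMix μ (MPE.conj T φ) := by
  intro A B hA hB
  have := h _ _ (φ.1.symm.measurable hA) (φ.1.symm.measurable hB)
  have e1 := mp_image_real φ hA
  have e2 := mp_image_real φ hB
  simp only [Measure.real] at e1 e2
  simp_rw [conj_measure T φ hA hB]
  simpa only [e1, e2] using this

/-- perturbation step for arbitrary `φ`. -/
lemma WMix.step' {X : Type*} [MeasurableSpace X] {μ : Measure X} [IsProbabilityMeasure μ]
    (T : X ≃ᵐ X) (hT : MeasurePreserving T μ μ) (h : WMix μ T)
    (𝒞 : Set (Set X)) (h𝒞 : ∀ C ∈ 𝒞, MeasurableSet C) (hent : 0 < famEntropy μ 𝒞) :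
    ∃ c > 0, ∀ (φ : MPE μ) (ι : Type) [Fintype ι] (π : X → ι),
      (∀ j, MeasurableSet (π ⁻¹' {j})) → ∀ N : ℕ,
      ∃ η : MPE μ, (∀ x, π (η.1 x) = π x) ∧ ∃ n ≥ N, ∃ C ∈ 𝒞,
      c < wmDev μ T ((η.1.trans φ.1).symm ⁻¹' C) n := by
  obtain ⟨c, hc, hcC⟩ := entropy_partition μ 𝒞 h𝒞 hent
  refine ⟨c ^ 2 / 200, by positivity, fun φ ι _ π hπ N => ?_⟩
  obtain ⟨A, hA, hA0⟩ := hcC Unit (fun _ => ()) (fun j => by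
    have : (fun _ : X => ()) ⁻¹' {j} = Set.univ := by ext; simp
    rw [this]; exact MeasurableSet.univ)
  have hAm := h𝒞 A hA
  have e : (fun _ : X => ()) ⁻¹' {()} = Set.univ := by ext; simp
  simp only [Finset.univ_unique, PUnit.default_eq_unit, Finset.sum_singleton, e,
    Set.univ_inter, ← Set.compl_eq_univ_sdiff] at hA0
  rw [probReal_compl_eq_one_sub hAm] at hA0
  have b1 := hA0.trans (min_le_left _ _)
  have b2 := hA0.trans (min_le_right _ _)
  obtain ⟨C, hC, hCc⟩ := hcC ι π hπ
  let T' : X ≃ᵐ X := (φ.1.trans T).trans φ.1.symm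
  have hT'c : (T' : X → X) = MPE.conj T φ := rfl
  have hT' : MeasurePreserving T' μ μ := (φ.2.symm φ.1).comp (hT.comp φ.2)
  obtain ⟨η, hη, n, hn, hd⟩ := WMix.step T' hT' (by rw [hT'c]; exact h.conj φ) π hπ (h𝒞 C hC) hc
    hCc hAm (by linarith) (by linarith) N
  refine ⟨η, hη, n, hn, C, hC, ?_⟩
  rw [hT'c, conj_dev T φ (η.1.symm.measurable (h𝒞 C hC))] at hd
  exact hd


def Cyl {X : Type*} [MeasurableSpace X] (e : X ≃ᵐ (ℕ → Bool)) (m : ℕ) (A : Set X) : Prop :=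
  ∀ x y, (∀ i < m, e x i = e y i) → (x ∈ A ↔ y ∈ A)

lemma Cyl.mono {X : Type*} [MeasurableSpace X] {e : X ≃ᵐ (ℕ → Bool)} {m n : ℕ} {A : Set X}
    (h : Cyl e m A) (hmn : m ≤ n) : Cyl e n A :=
  fun x y hxy => h x y fun i hi => hxy i (hi.trans_le hmn)

lemma coord_measurable {X : Type*} [MeasurableSpace X] (e : X ≃ᵐ (ℕ → Bool)) (i : ℕ) :
    Measurable fun x => e x i := (measurable_pi_apply i).comp e.measurable

lemma Cyl.measurableSet {X : Type*} [MeasurableSpace X] {e : X ≃ᵐ (ℕ → Bool)} {m : ℕ} {A : Set X}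
    (h : Cyl e m A) : MeasurableSet A := by
  have hp : Measurable (fun x => (fun i : Fin m => e x i)) :=
    measurable_pi_lambda _ fun i => coord_measurable e i
  have : A = (fun x => (fun i : Fin m => e x i)) ⁻¹' ((fun x => (fun i : Fin m => e x i)) '' A) := by
    ext x
    constructor
    · intro hx; exact ⟨x, hx, rfl⟩
    · rintro ⟨y, hy, hyx⟩
      exact (h y x fun i hi => congrFun hyx ⟨i, hi⟩).1 hy
  rw [this]
  exact hp (Set.toFinite _).measurableSet

lemma cyl_ring {X : Type*} [MeasurableSpace X] (e : X ≃ᵐ (ℕ → Bool)) :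
    IsSetRing {A | ∃ m, Cyl e m A} where
  empty_mem := ⟨0, fun x y _ => by simp⟩
  union_mem := by
    rintro s t ⟨m, hm⟩ ⟨n, hn⟩
    refine ⟨max m n, fun x y hxy => ?_⟩
    have h1 := hm.mono (le_max_left m n) x y hxy
    have h2 := hn.mono (le_max_right m n) x y hxy
    simp [h1, h2]
  sdiff_mem := by
    rintro s t ⟨m, hm⟩ ⟨n, hn⟩
    refine ⟨max m n, fun x y hxy => ?_⟩
    have h1 := hm.mono (le_max_left m n) x y hxy
    have h2 := hn.mono (le_max_right m n) x y hxy
    simp [h1, h2]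

lemma cyl_univ {X : Type*} [MeasurableSpace X] (e : X ≃ᵐ (ℕ → Bool)) :
    Cyl e 0 Set.univ := fun x y _ => by simp

lemma cyl_coord {X : Type*} [MeasurableSpace X] (e : X ≃ᵐ (ℕ → Bool)) (i : ℕ) (S : Set Bool) :
    Cyl e (i+1) {x | e x i ∈ S} := fun x y h => by simp [h i (by omega)]

lemma cyl_generate {X : Type*} [m0 : MeasurableSpace X] (e : X ≃ᵐ (ℕ → Bool)) :
    m0 = MeasurableSpace.generateFrom {A | ∃ m, Cyl e m A} := by
  apply le_antisymm
  · intro s hs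
    have he : @Measurable _ _ (MeasurableSpace.generateFrom {A | ∃ m, Cyl e m A}) _ e := by
      rw [@measurable_pi_iff]
      intro i S _
      exact MeasurableSpace.measurableSet_generateFrom ⟨i+1, cyl_coord e i S⟩
    have : s = e ⁻¹' (e.symm ⁻¹' s) := by ext; simp
    rw [this]
    exact he (e.symm.measurable hs)
  · apply MeasurableSpace.generateFrom_le
    rintro A ⟨m, hm⟩
    exact hm.measurableSet

lemma cyl_approx {X : Type*} [MeasurableSpace X] (μ : Measure X) [IsFiniteMeasure μ]
    (e : X ≃ᵐ (ℕ → Bool)) {s : Set X} (hs : MeasurableSet s) {ε : ENNReal} (hε : 0 < ε) :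
    ∃ m A, Cyl e m A ∧ μ (symmDiff A s) < ε := by
  obtain ⟨t, ⟨m, ht⟩, h⟩ := exists_measure_symmDiff_lt_of_generateFrom_isSetRing (μ := μ) (cyl_ring e)
    ⟨{Set.univ}, by simp, by simpa using ⟨0, cyl_univ e⟩, by simp⟩ (cyl_generate e) hs hε
  exact ⟨m, t, ht, h⟩

lemma mp_of_cyl {X : Type*} [MeasurableSpace X] {μ : Measure X} [IsProbabilityMeasure μ]
    (e : X ≃ᵐ (ℕ → Bool)) {f : X → X} (hf : Measurable f)
    (h : ∀ m A, Cyl e m A → μ (f ⁻¹' A) = μ A) : MeasurePreserving f μ μ := by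
  refine ⟨hf, (ext_of_generate_finite _ (cyl_generate e) ?_ ?_ ?_).symm⟩
  · intro s hs t ht _
    exact (cyl_ring e).inter_mem hs ht
  · rintro s ⟨m, hs⟩
    rw [Measure.map_apply hf hs.measurableSet, h m s hs]
  · rw [Measure.map_apply hf MeasurableSet.univ]; simp

def MPE.inv' {X : Type*} [MeasurableSpace X] {μ : Measure X} (φ : MPE μ) : MPE μ :=
  ⟨φ.1.symm, φ.2.symm φ.1⟩

lemma cyl_preimage {X : Type*} [MeasurableSpace X] {e : X ≃ᵐ (ℕ → Bool)} {f g : X → X} {m : ℕ}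
    (hfg : ∀ x, ∀ i < m, e (f x) i = e (g x) i) {A : Set X} (hA : Cyl e m A) :
    f ⁻¹' A = g ⁻¹' A := by
  ext x; exact hA _ _ (hfg x)

lemma limit_mp {X : Type*} [MeasurableSpace X] {μ : Measure X} [IsProbabilityMeasure μ]
    (e : X ≃ᵐ (ℕ → Bool)) (φ : ℕ → MPE μ) {f : X → X} (hf : Measurable f)
    (H : ∀ m, ∃ l, ∀ x, ∀ i < m, e (f x) i = e ((φ l).1 x) i) : MeasurePreserving f μ μ := by
  apply mp_of_cyl e hf
  intro m A hA
  obtain ⟨l, hl⟩ := H m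
  rw [cyl_preimage hl hA]
  exact (φ l).2.measure_preimage hA.measurableSet.nullMeasurableSet

lemma limit_inv {X : Type*} [MeasurableSpace X] {μ : Measure X} [IsProbabilityMeasure μ]
    (e : X ≃ᵐ (ℕ → Bool)) (φ : ℕ → MPE μ) {f h : X → X} (hf : Measurable f) (hh : Measurable h)
    (H : ∀ m, ∃ l, (∀ x, ∀ i < m, e (f x) i = e ((φ l).1 x) i) ∧
      ∀ x, ∀ i < m, e (h x) i = e ((φ l).1.symm x) i) : ∀ᵐ x ∂μ, h (f x) = x := by
  have hfm : MeasurePreserving f μ μ := limit_mp e φ hf fun m => (H m).imp fun l hl => hl.1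
  have key : ∀ i, ∀ᵐ x ∂μ, (e (h (f x)) i ∈ ({true} : Set Bool) ↔ e x i ∈ ({true} : Set Bool)) := by
    intro i
    set A := {x | e x i ∈ ({true} : Set Bool)} with hA
    have hAc : Cyl e (i+1) A := cyl_coord e i _
    set B := h ⁻¹' A with hB
    have hBm : MeasurableSet B := hh hAc.measurableSet
    have h0 : μ (symmDiff (f ⁻¹' B) A) = 0 := by
      by_contra hne
      have hpos : 0 < μ (symmDiff (f ⁻¹' B) A) / 2 := by
        simp only [ENNReal.half_pos hne]
      obtain ⟨m, A', hA', hlt⟩ := cyl_approx μ e hBm hpos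
      obtain ⟨l, hl1, hl2⟩ := H (max m (i+1))
      have e1 : f ⁻¹' A' = (φ l).1 ⁻¹' A' := cyl_preimage hl1 (hA'.mono (le_max_left _ _))
      have e2 : B = (φ l).1.symm ⁻¹' A := cyl_preimage hl2 (hAc.mono (le_max_right _ _))
      have e3 : (φ l).1 ⁻¹' B = A := by rw [e2]; ext; simp
      have hs : MeasurableSet (symmDiff A' B) := hA'.measurableSet.symmDiff hBm
      have m1 : μ (symmDiff (f ⁻¹' B) (f ⁻¹' A')) = μ (symmDiff A' B) := by
        rw [symmDiff_comm, ← Set.preimage_symmDiff]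
        exact hfm.measure_preimage hs.nullMeasurableSet
      have m2 : μ (symmDiff (f ⁻¹' A') A) = μ (symmDiff A' B) := by
        rw [e1, ← e3, ← Set.preimage_symmDiff]
        exact (φ l).2.measure_preimage hs.nullMeasurableSet
      have m3 := measure_symmDiff_le (μ := μ) (f ⁻¹' B) (f ⁻¹' A') A
      rw [m1, m2] at m3
      have : μ (symmDiff A' B) + μ (symmDiff A' B) < μ (symmDiff (f ⁻¹' B) A) := by
        calc _ < μ (symmDiff (f ⁻¹' B) A) / 2 + μ (symmDiff (f ⁻¹' B) A) / 2 :=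
              ENNReal.add_lt_add hlt hlt
          _ = _ := ENNReal.add_halves _
      exact absurd m3 (not_le.2 this)
    have := measure_symmDiff_eq_zero_iff.1 h0
    filter_upwards [this] with x hx
    have hx' : (x ∈ f ⁻¹' B) = (x ∈ A) := hx
    exact iff_of_eq hx'
  filter_upwards [ae_all_iff.2 key] with x hx
  apply e.injective
  funext i
  have := hx i
  simp only [Set.mem_singleton_iff] at this
  exact Bool.eq_iff_iff.2 this

/-- an uncountable null set -/
lemma exists_null {X : Type*} [MeasurableSpace X] [StandardBorelSpace X] (μ : Measure X)
    [IsProbabilityMeasure μ] (e : X ≃ᵐ (ℕ → Bool)) :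
    ∃ Z : Set X, MeasurableSet Z ∧ ¬ Z.Countable ∧ μ Z = 0 := by
  have hu : ¬ Countable (ℕ → Bool) := by
    intro h
    have h3 : Cardinal.mk (ℕ → Bool) ≤ Cardinal.aleph0 := Cardinal.mk_le_aleph0_iff.2 h
    have h4 : Cardinal.mk (ℕ → Bool) = 2 ^ Cardinal.aleph0 := by
      rw [← Cardinal.power_def]; simp
    rw [h4] at h3
    exact absurd h3 (not_le.2 (Cardinal.cantor _))
  have hinj : Function.Injective (fun a : ℕ → Bool => (a, (fun _ => false : ℕ → Bool))) :=
    fun a b h => congrArg Prod.fst h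
  have hu2 : ¬ Countable ((ℕ → Bool) × (ℕ → Bool)) := fun h => hu hinj.countable
  have hX : ¬ Countable X := fun h => hu e.symm.injective.countable
  let g : X ≃ᵐ ((ℕ → Bool) × (ℕ → Bool)) := PolishSpace.measurableEquivOfNotCountable hX hu2
  have hg : Measurable fun x => (g x).1 := measurable_fst.comp g.measurable
  have hc := Measure.countable_meas_level_set_pos (μ := μ) hg
  have : ∃ a, a ∉ {t | 0 < μ {x | (g x).1 = t}} := by
    by_contra! hall
    exact hu (Set.countable_univ_iff.1 (hc.mono fun a _ => hall a))
  obtain ⟨a, ha⟩ := this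
  refine ⟨{x | (g x).1 = a}, hg (measurableSet_singleton a), fun hZ => hu ?_, by simpa using ha⟩
  have : Function.Injective (fun b : ℕ → Bool => (⟨g.symm (a, b), by simp⟩ : {x | (g x).1 = a})) := by
    intro b b' hbb
    have := congrArg (fun z : {x | (g x).1 = a} => (g z.1).2) hbb
    simpa using this
  have := hZ.to_subtype
  exact Function.Injective.countable ‹Function.Injective _›


lemma upgrade {X : Type*} [MeasurableSpace X] [StandardBorelSpace X] {μ : Measure X}
    [IsProbabilityMeasure μ] (e : X ≃ᵐ (ℕ → Bool)) {f h : X → X}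
    (hf : MeasurePreserving f μ μ) (hh : MeasurePreserving h μ μ)
    (h1 : ∀ᵐ x ∂μ, h (f x) = x) (h2 : ∀ᵐ x ∂μ, f (h x) = x) :
    ∃ ψ : MPE μ, ∀ᵐ x ∂μ, ψ.1.symm x = h x := by
  classical
  obtain ⟨Z, hZ, hZu, hZ0⟩ := exists_null μ e
  let _ := upgradeStandardBorel X
  set A : Set X := {x | h (f x) = x} ∩ (Zᶜ ∩ f ⁻¹' Zᶜ) with hA
  set B : Set X := {x | f (h x) = x} ∩ (Zᶜ ∩ h ⁻¹' Zᶜ) with hB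
  have hAm : MeasurableSet A := (measurableSet_eq_fun (hh.measurable.comp hf.measurable)
    measurable_id).inter (hZ.compl.inter (hf.measurable hZ.compl))
  have hBm : MeasurableSet B := (measurableSet_eq_fun (hf.measurable.comp hh.measurable)
    measurable_id).inter (hZ.compl.inter (hh.measurable hZ.compl))
  have hZae : ∀ᵐ x ∂μ, x ∈ Zᶜ := by
    rw [ae_iff]; simpa using hZ0
  have hAae : ∀ᵐ x ∂μ, x ∈ A := by
    filter_upwards [h1, hZae, hf.quasiMeasurePreserving.ae hZae] with x a b c
    exact ⟨a, b, c⟩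
  have hBae : ∀ᵐ x ∂μ, x ∈ B := by
    filter_upwards [h2, hZae, hh.quasiMeasurePreserving.ae hZae] with x a b c
    exact ⟨a, b, c⟩
  have hfAB : ∀ x ∈ A, f x ∈ B := by
    rintro x ⟨a, b, c⟩
    have a' : h (f x) = x := a
    refine ⟨?_, c, ?_⟩
    · show f (h (f x)) = f x
      rw [a']
    · show h (f x) ∈ Zᶜ
      rwa [a']
  have hhBA : ∀ x ∈ B, h x ∈ A := by
    rintro x ⟨a, b, c⟩
    have a' : f (h x) = x := a
    refine ⟨?_, c, ?_⟩
    · show h (f (h x)) = h x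
      rw [a']
    · show f (h x) ∈ Zᶜ
      rwa [a']
  let q1 : A ≃ᵐ B :=
    { toFun := fun x => ⟨f x, hfAB x x.2⟩
      invFun := fun y => ⟨h y, hhBA y y.2⟩
      left_inv := fun x => Subtype.ext x.2.1
      right_inv := fun x => Subtype.ext x.2.1
      measurable_toFun := (hf.measurable.comp measurable_subtype_coe).subtype_mk
      measurable_invFun := (hh.measurable.comp measurable_subtype_coe).subtype_mk }
  have hZA : Z ⊆ Aᶜ := fun x hx hx' => hx'.2.1 hx
  have hZB : Z ⊆ Bᶜ := fun x hx hx' => hx'.2.1 hx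
  have uA : ¬ Countable (Aᶜ : Set X) := fun hc => hZu ((Set.to_countable _).mono hZA)
  have uB : ¬ Countable (Bᶜ : Set X) := fun hc => hZu ((Set.to_countable _).mono hZB)
  have := hAm.compl.standardBorel
  have := hBm.compl.standardBorel
  let q2 : (Aᶜ : Set X) ≃ᵐ (Bᶜ : Set X) := PolishSpace.measurableEquivOfNotCountable uA uB
  let q : X ≃ᵐ X := ((MeasurableEquiv.sumCompl hAm).symm.trans
    (MeasurableEquiv.sumCongr q1 q2)).trans (MeasurableEquiv.sumCompl hBm)
  have hqA : ∀ x ∈ A, q x = f x := by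
    intro x hx
    have : (MeasurableEquiv.sumCompl hAm).symm x = Sum.inl ⟨x, hx⟩ := by
      rw [MeasurableEquiv.symm_apply_eq]; rfl
    show (MeasurableEquiv.sumCompl hBm) ((MeasurableEquiv.sumCongr q1 q2)
      ((MeasurableEquiv.sumCompl hAm).symm x)) = f x
    rw [this]; rfl
  have hqmp : MeasurePreserving q μ μ := by
    refine ⟨q.measurable, ?_⟩
    refine Eq.trans (Measure.map_congr ?_) hf.map_eq
    filter_upwards [hAae] with x hx using hqA x hx
  refine ⟨⟨q, hqmp⟩, ?_⟩
  filter_upwards [hBae] with y hy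
  show q.symm y = h y
  rw [MeasurableEquiv.symm_apply_eq, hqA _ (hhBA y hy)]
  exact hy.1.symm

lemma limit_exists {X : Type*} [MeasurableSpace X] [StandardBorelSpace X] {μ : Measure X}
    [IsProbabilityMeasure μ] (e : X ≃ᵐ (ℕ → Bool)) (φ : ℕ → MPE μ) (r : ℕ → ℕ)
    (hr : ∀ k, r k < r (k+1))
    (H1 : ∀ k x, ∀ i < r k, e ((φ (k+1)).1 x) i = e ((φ k).1 x) i)
    (H2 : ∀ k x, ∀ i < r k, e ((φ (k+1)).1.symm x) i = e ((φ k).1.symm x) i) :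
    ∃ ψ : MPE μ, ∀ k A, Cyl e (r k) A →
      μ (symmDiff (ψ.1.symm ⁻¹' A) ((φ k).1.symm ⁻¹' A)) = 0 := by
  have hmono : StrictMono r := strictMono_nat_of_lt_succ hr
  have G1 : ∀ k l, k ≤ l → ∀ x, ∀ i < r k, e ((φ l).1 x) i = e ((φ k).1 x) i := by
    intro k l hkl x i hi
    induction l, hkl using Nat.le_induction with
    | base => rfl
    | succ l hl ih => rw [H1 l x i (hi.trans_le (hmono.monotone hl)), ih]
  have G2 : ∀ k l, k ≤ l → ∀ x, ∀ i < r k, e ((φ l).1.symm x) i = e ((φ k).1.symm x) i := by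
    intro k l hkl x i hi
    induction l, hkl using Nat.le_induction with
    | base => rfl
    | succ l hl ih => rw [H2 l x i (hi.trans_le (hmono.monotone hl)), ih]
  let f : X → X := fun x => e.symm (fun i => e ((φ (i+1)).1 x) i)
  let h : X → X := fun x => e.symm (fun i => e ((φ (i+1)).1.symm x) i)
  have hf : Measurable f := e.symm.measurable.comp
    (measurable_pi_lambda _ fun i => (coord_measurable e i).comp (φ (i+1)).1.measurable)
  have hh : Measurable h := e.symm.measurable.comp
    (measurable_pi_lambda _ fun i => (coord_measurable e i).comp (φ (i+1)).1.symm.measurable)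
  have hid : ∀ i, i < r (i+1) := fun i => lt_of_lt_of_le (Nat.lt_succ_self i) (hmono.id_le (i+1))
  have F1 : ∀ k x, ∀ i < r k, e (f x) i = e ((φ k).1 x) i := by
    intro k x i hi
    simp only [f, MeasurableEquiv.apply_symm_apply]
    rcases le_total k (i+1) with hk | hk
    · exact G1 k (i+1) hk x i hi
    · exact (G1 (i+1) k hk x i (hid i)).symm
  have F2 : ∀ k x, ∀ i < r k, e (h x) i = e ((φ k).1.symm x) i := by
    intro k x i hi
    simp only [h, MeasurableEquiv.apply_symm_apply]
    rcases le_total k (i+1) with hk | hk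
    · exact G2 k (i+1) hk x i hi
    · exact (G2 (i+1) k hk x i (hid i)).symm
  have hle : ∀ m, m ≤ r m := hmono.id_le
  have K1 := limit_inv e φ hf hh fun m => ⟨m, fun x i hi => F1 m x i (hi.trans_le (hle m)),
    fun x i hi => F2 m x i (hi.trans_le (hle m))⟩
  have K2 := limit_inv e (fun k => (φ k).inv') hh hf fun m =>
    ⟨m, fun x i hi => F2 m x i (hi.trans_le (hle m)), fun x i hi => F1 m x i (hi.trans_le (hle m))⟩
  obtain ⟨ψ, hψ⟩ := upgrade e
    (limit_mp e φ hf fun m => ⟨m, fun x i hi => F1 m x i (hi.trans_le (hle m))⟩)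
    (limit_mp e (fun k => (φ k).inv') hh
      fun m => ⟨m, fun x i hi => F2 m x i (hi.trans_le (hle m))⟩) K1 K2
  refine ⟨ψ, fun k A hA => ?_⟩
  rw [measure_symmDiff_eq_zero_iff, ← cyl_preimage (F2 k) hA]
  filter_upwards [hψ] with x hx
  show (ψ.1.symm x ∈ A) = (h x ∈ A)
  rw [hx]

lemma wmDev_lip {X : Type*} [MeasurableSpace X] {μ : Measure X} [IsProbabilityMeasure μ]
    {T : X → X} (hT : MeasurePreserving T μ μ) {A B : Set X} (hA : MeasurableSet A)
    (hB : MeasurableSet B) (n : ℕ) :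
    wmDev μ T A n ≤ wmDev μ T B n + 4 * μ.real (symmDiff A B) := by
  unfold wmDev
  rcases Nat.eq_zero_or_pos n with rfl | hn
  · simp
  have hn' : (0:ℝ) < n := by exact_mod_cast hn
  have hlip : ∀ S S' : Set X, MeasurableSet S → MeasurableSet S' →
      |μ.real S - μ.real S'| ≤ μ.real (symmDiff S S') := by
    intro S S' hS hS'
    have a1 := measureReal_inter_add_sdiff (μ := μ) (s := S) hS'
    have a2 := measureReal_inter_add_sdiff (μ := μ) (s := S') hS
    have a3 : μ.real (S \ S') ≤ μ.real (symmDiff S S') := measureReal_mono (by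
      intro x hx; exact Or.inl hx)
    have a4 : μ.real (S' \ S) ≤ μ.real (symmDiff S S') := measureReal_mono (by
      intro x hx; exact Or.inr hx)
    have p1 : 0 ≤ μ.real (S \ S') := measureReal_nonneg
    have p2 : 0 ≤ μ.real (S' \ S) := measureReal_nonneg
    rw [Set.inter_comm S' S] at a2
    rw [abs_le]; constructor <;> linarith
  have hterm : ∀ i, |(μ (A ∩ T^[i] ⁻¹' A)).toReal - (μ A).toReal ^ 2| ≤
      |(μ (B ∩ T^[i] ⁻¹' B)).toReal - (μ B).toReal ^ 2| + 4 * μ.real (symmDiff A B) := by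
    intro i
    have hTi : MeasurePreserving T^[i] μ μ := hT.iterate i
    have b1 := hlip _ _ (hA.inter (hTi.measurable hA)) (hB.inter (hTi.measurable hB))
    have b2 := hlip _ _ hA hB
    have b3 : μ.real (symmDiff (A ∩ T^[i] ⁻¹' A) (B ∩ T^[i] ⁻¹' B)) ≤ 2 * μ.real (symmDiff A B) := by
      have s1 : symmDiff (A ∩ T^[i] ⁻¹' A) (B ∩ T^[i] ⁻¹' B) ⊆
          symmDiff A B ∪ T^[i] ⁻¹' (symmDiff A B) := by
        intro x
        simp only [Set.mem_symmDiff, Set.mem_inter_iff, Set.mem_preimage, Set.mem_union]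
        tauto
      calc _ ≤ μ.real (symmDiff A B ∪ T^[i] ⁻¹' (symmDiff A B)) := measureReal_mono s1
        _ ≤ μ.real (symmDiff A B) + μ.real (T^[i] ⁻¹' (symmDiff A B)) := measureReal_union_le _ _
        _ = _ := by rw [hTi.measureReal_preimage (hA.symmDiff hB).nullMeasurableSet]; ring
    have c1 : μ.real A ≤ 1 := measureReal_le_one
    have c2 : μ.real B ≤ 1 := measureReal_le_one
    have c3 : 0 ≤ μ.real A := measureReal_nonneg
    have c4 : 0 ≤ μ.real B := measureReal_nonneg
    have b4 : |μ.real A ^ 2 - μ.real B ^ 2| ≤ 2 * μ.real (symmDiff A B) := by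
      have : μ.real A ^ 2 - μ.real B ^ 2 = (μ.real A + μ.real B) * (μ.real A - μ.real B) := by ring
      rw [this, abs_mul]
      exact mul_le_mul (by rw [abs_of_nonneg (by positivity)]; linarith) b2 (abs_nonneg _) (by norm_num)
    change |μ.real (A ∩ T^[i] ⁻¹' A) - μ.real A ^ 2| ≤ |μ.real (B ∩ T^[i] ⁻¹' B) - μ.real B ^ 2| + _
    have b5 := b1.trans b3
    rw [abs_le] at b4 b5
    rw [abs_le]
    have q1 := le_abs_self (μ.real (B ∩ T^[i] ⁻¹' B) - μ.real B ^ 2)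
    have q2 := neg_abs_le (μ.real (B ∩ T^[i] ⁻¹' B) - μ.real B ^ 2)
    constructor <;> linarith [b4.1, b4.2, b5.1, b5.2]
  have := Finset.sum_le_sum (fun i (_ : i ∈ Finset.range n) => hterm i)
  rw [Finset.sum_add_distrib] at this
  simp only [Finset.sum_const, Finset.card_range, nsmul_eq_mul] at this
  rw [div_add' _ _ _ hn'.ne', div_le_div_iff_of_pos_right hn']
  linarith

lemma not_countable_of {X : Type*} [MeasurableSpace X] [StandardBorelSpace X] {μ : Measure X}
    [IsProbabilityMeasure μ] {T : X → X} (h : WMix μ T)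
    (𝒞 : Set (Set X)) (h𝒞 : ∀ C ∈ 𝒞, MeasurableSet C) (hent : 0 < famEntropy μ 𝒞) :
    ¬ Countable X := by
  intro hX
  obtain ⟨c, hc, hcC⟩ := entropy_partition μ 𝒞 h𝒞 hent
  obtain ⟨A, hA, hA0⟩ := hcC Unit (fun _ => ()) (fun j => by
    have : (fun _ : X => ()) ⁻¹' {j} = Set.univ := by ext; simp
    rw [this]; exact MeasurableSet.univ)
  have hall : ∃ x, μ {x} ≠ 0 := by
    by_contra! hall
    have : μ Set.univ = 0 := (measure_null_iff_singleton Set.countable_univ).2 fun x _ => hall x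
    simp at this
  obtain ⟨x, hx⟩ := hall
  have ha0 : 0 < μ.real {x} := ENNReal.toReal_pos hx (measure_ne_top _ _)
  have ha1 : μ.real {x} ≤ 1 := measureReal_le_one
  have hone : μ.real {x} = 1 := by
    by_contra hne
    have hlt : μ.real {x} < 1 := lt_of_le_of_ne ha1 hne
    set a := μ.real {x} with ha
    obtain ⟨k, hk⟩ := h.exists_near (measurableSet_singleton x) (measurableSet_singleton x)
      (ε := a * min a (1 - a)) (mul_pos ha0 (lt_min ha0 (by linarith)))
    rw [← ha] at hk
    have m1 := mul_le_mul_of_nonneg_left (min_le_left a (1-a)) ha0.le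
    have m2 := mul_le_mul_of_nonneg_left (min_le_right a (1-a)) ha0.le
    by_cases hxk : T^[k] x = x
    · have : ({x} : Set X) ∩ T^[k] ⁻¹' {x} = {x} := by
        ext y; simp only [Set.mem_inter_iff, Set.mem_singleton_iff, Set.mem_preimage]
        constructor
        · exact fun h => h.1
        · rintro rfl; exact ⟨rfl, hxk⟩
      rw [this, ← ha, abs_lt] at hk
      nlinarith [hk.2]
    · have : ({x} : Set X) ∩ T^[k] ⁻¹' {x} = ∅ := by
        ext y; simp only [Set.mem_inter_iff, Set.mem_singleton_iff, Set.mem_preimage,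
          Set.mem_empty_iff_false, iff_false, not_and]
        rintro rfl; exact hxk
      rw [this, abs_lt] at hk
      simp at hk
      nlinarith [hk.1]
  have hcompl : μ.real ({x}ᶜ) = 0 := by
    rw [probReal_compl_eq_one_sub (measurableSet_singleton x), hone]; simp
  have huniv : (fun _ : X => ()) ⁻¹' {()} = Set.univ := by ext; simp
  simp [huniv] at hA0
  by_cases hxA : x ∈ A
  · have : μ.real (Set.univ \ A) ≤ μ.real ({x}ᶜ) := measureReal_mono (by
      intro y hy hyx; rw [Set.mem_singleton_iff] at hyx; subst hyx; exact hy.2 hxA)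
    linarith [hA0.2]
  · have : μ.real A ≤ μ.real ({x}ᶜ) := measureReal_mono (by
      intro y hy hyx; rw [Set.mem_singleton_iff] at hyx; subst hyx; exact hxA hy)
    linarith [hA0.1]


lemma extend_step {X : Type*} [MeasurableSpace X] {μ : Measure X}
    [IsProbabilityMeasure μ] (e : X ≃ᵐ (ℕ → Bool)) {T : X ≃ᵐ X}
    {𝒞 : Set (Set X)} (h𝒞 : ∀ C ∈ 𝒞, MeasurableSet C) {c : ℝ} (hc : 0 < c)
    (hstep : ∀ (φ : MPE μ) (ι : Type) [Fintype ι] (π : X → ι),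
      (∀ j, MeasurableSet (π ⁻¹' {j})) → ∀ N : ℕ,
      ∃ η : MPE μ, (∀ x, π (η.1 x) = π x) ∧ ∃ n ≥ N, ∃ C ∈ 𝒞,
      c < wmDev μ T ((η.1.trans φ.1).symm ⁻¹' C) n) (k : ℕ) (p : MPE μ × ℕ) :
    ∃ p' : MPE μ × ℕ, p.2 < p'.2 ∧ (∀ x, ∀ i < p.2, e (p'.1.1 x) i = e (p.1.1 x) i) ∧
      (∀ x, ∀ i < p.2, e (p'.1.1.symm x) i = e (p.1.1.symm x) i) ∧
      ∃ n ≥ k, ∃ C ∈ 𝒞, c < wmDev μ T (p'.1.1.symm ⁻¹' C) n ∧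
        ∃ A, Cyl e p'.2 A ∧ μ.real (symmDiff A C) < c / 16 := by
  classical
  obtain ⟨φ, r⟩ := p
  have hπm : Measurable (fun x => ((fun i : Fin r => e x i), (fun i : Fin r => e (φ.1 x) i))) :=
    Measurable.prodMk
      (measurable_pi_lambda (fun x => (fun i : Fin r => e x i)) fun i => coord_measurable e i)
      (measurable_pi_lambda (fun x => (fun i : Fin r => e (φ.1 x) i))
        fun i => (coord_measurable e i).comp φ.1.measurable)
  obtain ⟨η, hη, n, hn, C, hC, hlt⟩ := hstep φ ((Fin r → Bool) × (Fin r → Bool))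
    (fun x => ((fun i : Fin r => e x i), (fun i : Fin r => e (φ.1 x) i)))
    (fun j => hπm (measurableSet_singleton j)) k
  obtain ⟨m, A, hA, hAC⟩ := cyl_approx μ e (h𝒞 C hC) (ε := ENNReal.ofReal (c/16))
    (by simpa using by positivity)
  have h1 : ∀ x, ∀ i < r, e (η.1 x) i = e x i := fun x i hi =>
    congrFun (congrArg Prod.fst (hη x)) ⟨i, hi⟩
  have h2 : ∀ x, ∀ i < r, e (φ.1 (η.1 x)) i = e (φ.1 x) i := fun x i hi =>
    congrFun (congrArg Prod.snd (hη x)) ⟨i, hi⟩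
  refine ⟨(⟨η.1.trans φ.1, φ.2.comp η.2⟩, max (r+1) m), ?_, ?_, ?_, n, hn, C, hC, hlt, A,
    hA.mono (le_max_right _ _), ?_⟩
  · exact lt_of_lt_of_le (Nat.lt_succ_self r) (le_max_left _ _)
  · intro x i hi; exact h2 x i hi
  · intro x i hi
    have := h1 (η.1.symm (φ.1.symm x)) i hi
    rw [MeasurableEquiv.apply_symm_apply] at this
    exact this.symm
  · exact (ENNReal.lt_ofReal_iff_toReal_lt (measure_ne_top _ _)).1 hAC

lemma symmDiff_tri {X : Type*} [MeasurableSpace X] {μ : Measure X} [IsProbabilityMeasure μ]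
    (A B C : Set X) : μ.real (symmDiff A C) ≤ μ.real (symmDiff A B) + μ.real (symmDiff B C) := by
  refine le_trans (measureReal_mono ?_) (measureReal_union_le _ _)
  exact symmDiff_triangle A B C

lemma symmDiff_approx {X : Type*} [MeasurableSpace X] {μ : Measure X} [IsProbabilityMeasure μ]
    (ψ φ : MPE μ) {A C : Set X} (hA : MeasurableSet A) (hC : MeasurableSet C)
    (h : μ (symmDiff (ψ.1.symm ⁻¹' A) (φ.1.symm ⁻¹' A)) = 0) :
    μ.real (symmDiff (ψ.1.symm ⁻¹' C) (φ.1.symm ⁻¹' C)) ≤ 2 * μ.real (symmDiff A C) := by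
  have t1 := symmDiff_tri (μ := μ) (ψ.1.symm ⁻¹' C) (ψ.1.symm ⁻¹' A) (φ.1.symm ⁻¹' C)
  have t2 := symmDiff_tri (μ := μ) (ψ.1.symm ⁻¹' A) (φ.1.symm ⁻¹' A) (φ.1.symm ⁻¹' C)
  have h' : μ.real (symmDiff (ψ.1.symm ⁻¹' A) (φ.1.symm ⁻¹' A)) = 0 := by
    rw [Measure.real, h]; rfl
  rw [← Set.preimage_symmDiff, mp_image_real _ (hC.symmDiff hA)] at t1
  rw [← Set.preimage_symmDiff (s := A) (t := C), mp_image_real _ (hA.symmDiff hC)] at t2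
  rw [symmDiff_comm C A] at t1
  linarith

lemma dense_step {X : Type*} [MeasurableSpace X] [StandardBorelSpace X] {μ : Measure X}
    [IsProbabilityMeasure μ] (e : X ≃ᵐ (ℕ → Bool)) {T : X ≃ᵐ X} (hT : MeasurePreserving T μ μ)
    {𝒞 : Set (Set X)} (h𝒞 : ∀ C ∈ 𝒞, MeasurableSet C) {c : ℝ} (hc : 0 < c)
    (hstep : ∀ (φ : MPE μ) (ι : Type) [Fintype ι] (π : X → ι),
      (∀ j, MeasurableSet (π ⁻¹' {j})) → ∀ N : ℕ,
      ∃ η : MPE μ, (∀ x, π (η.1 x) = π x) ∧ ∃ n ≥ N, ∃ C ∈ 𝒞,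
      c < wmDev μ T ((η.1.trans φ.1).symm ⁻¹' C) n) (φ0 : MPE μ) (m0 : ℕ) :
    ∃ ψ : MPE μ, (∀ N : ℕ, ∃ n ≥ N, ∃ C ∈ 𝒞, c / 2 < wmDev μ T (ψ.1.symm ⁻¹' C) n) ∧
      ∀ A, Cyl e m0 A → μ (symmDiff (ψ.1.symm ⁻¹' A) (φ0.1.symm ⁻¹' A)) = 0 := by
  choose F F1 F2 F3 F4 using extend_step (μ := μ) e h𝒞 hc hstep
  let p : ℕ → MPE μ × ℕ := fun k => Nat.rec (φ0, m0) (fun k q => F k q) k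
  have hp : ∀ k, p (k+1) = F k (p k) := fun k => rfl
  obtain ⟨ψ, hψ⟩ := limit_exists e (fun k => (p k).1) (fun k => (p k).2)
    (fun k => F1 k (p k)) (fun k => F2 k (p k)) (fun k => F3 k (p k))
  refine ⟨ψ, fun N => ?_, hψ 0⟩
  obtain ⟨n, hn, C, hC, hlt, A, hA, hAC⟩ := F4 N (p N)
  refine ⟨n, hn, C, hC, ?_⟩
  have h0 := hψ (N+1) A hA
  have h1 := symmDiff_approx ψ (p (N+1)).1 hA.measurableSet (h𝒞 C hC) h0
  have h2 := wmDev_lip hT ((p (N+1)).1.1.symm.measurable (h𝒞 C hC))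
    (ψ.1.symm.measurable (h𝒞 C hC)) n
  rw [symmDiff_comm] at h2
  rw [← hp] at hlt
  linarith

lemma dist_ind {X : Type*} [MeasurableSpace X] {μ : Measure X} [IsProbabilityMeasure μ]
    {A B : Set X} (hA : MeasurableSet A) (hB : MeasurableSet B) :
    dist (indicatorConstLp 1 hA (measure_ne_top μ _) (1 : ℝ) : Lp ℝ 1 μ)
      (indicatorConstLp 1 hB (measure_ne_top μ _) (1 : ℝ) : Lp ℝ 1 μ) =
      μ.real (symmDiff A B) := by
  rw [dist_indicatorConstLp_eq_norm, norm_indicatorConstLp (by simp) (by simp)]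
  simp

lemma tendsto_MPE {X : Type*} [MeasurableSpace X] {μ : Measure X} [IsProbabilityMeasure μ]
    {ι : Type*} {l : Filter ι} {ψ : ι → MPE μ} {φ : MPE μ} :
    Tendsto ψ l (nhds φ) ↔ ∀ A, MeasurableSet A →
      Tendsto (fun k => μ.real (symmDiff ((ψ k).1.symm ⁻¹' A) (φ.1.symm ⁻¹' A))) l (nhds 0) := by
  rw [nhds_induced, tendsto_comap_iff, tendsto_pi_nhds]
  simp only [Function.comp_def, Subtype.forall]
  refine forall_congr' fun A => forall_congr' fun hA => ?_
  rw [tendsto_iff_dist_tendsto_zero]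
  simp_rw [dist_ind]

lemma continuous_dev {X : Type*} [MeasurableSpace X] {μ : Measure X} [IsProbabilityMeasure μ]
    {T : X → X} (hT : MeasurePreserving T μ μ) {C : Set X} (hC : MeasurableSet C) (n : ℕ) :
    Continuous fun φ : MPE μ => wmDev μ T (φ.1.symm ⁻¹' C) n := by
  rw [continuous_iff_continuousAt]
  intro φ
  have h := (tendsto_MPE (μ := μ) (l := nhds φ) (ψ := id) (φ := φ)).1 tendsto_id C hC
  have h4 := h.const_mul 4
  rw [mul_zero] at h4
  unfold ContinuousAt
  rw [tendsto_iff_dist_tendsto_zero]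
  refine squeeze_zero (fun _ => dist_nonneg) (fun ψ => ?_) h4
  have a1 := wmDev_lip hT (ψ.1.symm.measurable hC) (φ.1.symm.measurable hC) n
  have a2 := wmDev_lip hT (φ.1.symm.measurable hC) (ψ.1.symm.measurable hC) n
  rw [symmDiff_comm] at a2
  rw [Real.dist_eq, abs_le]
  simp only [id]
  constructor <;> linarith

lemma wmDev_nonneg {X : Type*} [MeasurableSpace X] (μ : Measure X) (T : X → X) (C : Set X) (n : ℕ) :
    0 ≤ wmDev μ T C n := by unfold wmDev; positivity

lemma wmDev_le_one {X : Type*} [MeasurableSpace X] (μ : Measure X) [IsProbabilityMeasure μ]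
    (T : X → X) (C : Set X) (n : ℕ) : wmDev μ T C n ≤ 1 := by
  unfold wmDev
  rcases Nat.eq_zero_or_pos n with rfl | hn
  · simp
  rw [div_le_one (by exact_mod_cast hn)]
  have : ∀ i ∈ Finset.range n, |(μ (C ∩ T^[i] ⁻¹' C)).toReal - (μ C).toReal ^ 2| ≤ 1 := by
    intro i _
    have c1 : μ.real C ≤ 1 := measureReal_le_one
    have c2 : μ.real (C ∩ T^[i] ⁻¹' C) ≤ 1 := measureReal_le_one
    have c3 : 0 ≤ μ.real C := measureReal_nonneg
    have c4 : 0 ≤ μ.real (C ∩ T^[i] ⁻¹' C) := measureReal_nonneg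
    change |μ.real (C ∩ T^[i] ⁻¹' C) - μ.real C ^ 2| ≤ 1
    rw [abs_le]; constructor <;> nlinarith
  simpa using Finset.sum_le_sum this

/-- If `T` is an invertible weak mixing transformation of a Lebesgue probability space
(formalized as a standard Borel space with a probability measure) and `H_μ(𝒞) > 0`, then there
is a dense `G_δ` set `G ⊆ Φ` such that uniform weak mixing over `𝒞` fails for `T_φ` for every
`φ ∈ G`. -/
theorem dense_Gdelta_uniform_weak_mixing_fails_of_pos_entropy
    {X : Type*} [MeasurableSpace X] [StandardBorelSpace X]
    (μ : Measure X) [IsProbabilityMeasure μ]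
    (T : X ≃ᵐ X) (hT : MeasurePreserving (⇑T) μ μ)
    (hmix : ∀ A B : Set X, MeasurableSet A → MeasurableSet B →
      Tendsto (fun n : ℕ =>
          (∑ i ∈ Finset.range n,
            |(μ (A ∩ ((⇑T)^[i]) ⁻¹' B)).toReal - (μ A).toReal * (μ B).toReal|) / n)
        atTop (nhds 0))
    (𝒞 : Set (Set X)) (h𝒞 : ∀ C ∈ 𝒞, MeasurableSet C) (hent : 0 < famEntropy μ 𝒞) :
    ∃ G : Set (MPE μ), IsGδ G ∧ Dense G ∧ ∀ φ ∈ G,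
      0 < Filter.atTop.limsup (fun n : ℕ => ⨆ C : 𝒞,
        (∑ i ∈ Finset.range n,
          |(μ ((C : Set X) ∩ ((MPE.conj T φ)^[i]) ⁻¹' (C : Set X))).toReal -
            (μ (C : Set X)).toReal ^ 2|) / n) := by
  have hW : WMix μ T := hmix
  have e : X ≃ᵐ (ℕ → Bool) :=
    PolishSpace.measurableEquivNatBoolOfNotCountable (not_countable_of hW 𝒞 h𝒞 hent)
  obtain ⟨c, hc, hstep⟩ := hW.step' T hT 𝒞 h𝒞 hent
  refine ⟨⋂ N : ℕ, {φ : MPE μ | ∃ n ≥ N, ∃ C ∈ 𝒞, c / 2 < wmDev μ T (φ.1.symm ⁻¹' C) n},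
    ?_, ?_, ?_⟩
  · refine IsGδ.iInter_of_isOpen fun N => ?_
    have : {φ : MPE μ | ∃ n ≥ N, ∃ C ∈ 𝒞, c / 2 < wmDev μ T (φ.1.symm ⁻¹' C) n} =
        ⋃ n, ⋃ (_ : n ≥ N), ⋃ C, ⋃ (_ : C ∈ 𝒞),
          {φ : MPE μ | c / 2 < wmDev μ T (φ.1.symm ⁻¹' C) n} := by
      ext φ; simp
    rw [this]
    exact isOpen_iUnion fun n => isOpen_iUnion fun _ => isOpen_iUnion fun C => isOpen_iUnion
      fun hC => isOpen_lt continuous_const (continuous_dev hT (h𝒞 C hC) n)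
  · intro φ0
    choose ψ h1 h2 using fun m => dense_step e hT h𝒞 hc hstep φ0 m
    refine mem_closure_of_tendsto (b := atTop) (f := ψ) ?_ (Eventually.of_forall fun m => ?_)
    · rw [tendsto_MPE]
      intro A hA
      rw [Metric.tendsto_atTop]
      intro ε hε
      obtain ⟨m, B, hB, hBA⟩ := cyl_approx μ e hA (ε := ENNReal.ofReal (ε/2))
        (by simpa using hε)
      refine ⟨m, fun k hk => ?_⟩
      have := symmDiff_approx (ψ k) φ0 hB.measurableSet hA (h2 k B (hB.mono hk))
      have h3 := (ENNReal.lt_ofReal_iff_toReal_lt (measure_ne_top _ _)).1 hBA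
      change μ.real (symmDiff B A) < _ at h3
      rw [Real.dist_eq, sub_zero, abs_of_nonneg measureReal_nonneg]
      linarith
    · exact Set.mem_iInter.2 fun N => h1 m N
  · intro φ hφ
    rw [Set.mem_iInter] at hφ
    have hbdd : ∀ n, BddAbove (Set.range fun C : 𝒞 => wmDev μ (MPE.conj T φ) (C : Set X) n) := by
      intro n
      refine ⟨1, ?_⟩
      rintro _ ⟨C, rfl⟩
      exact wmDev_le_one _ _ _ _
    have hle1 : ∀ n, (⨆ C : 𝒞, wmDev μ (MPE.conj T φ) (C : Set X) n) ≤ 1 := fun n =>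
      Real.iSup_le (fun C => wmDev_le_one _ _ _ _) zero_le_one
    change 0 < Filter.atTop.limsup (fun n : ℕ => ⨆ C : 𝒞, wmDev μ (MPE.conj T φ) (C : Set X) n)
    refine lt_of_lt_of_le (half_pos hc) (le_limsup_of_frequently_le ?_ ?_)
    · rw [frequently_atTop]
      intro N
      obtain ⟨n, hn, C, hC, hlt⟩ := hφ N
      refine ⟨n, hn, ?_⟩
      rw [← conj_dev T φ (h𝒞 C hC)] at hlt
      exact hlt.le.trans (le_ciSup (hbdd n) (⟨C, hC⟩ : 𝒞))
    · exact isBoundedUnder_of ⟨1, hle1⟩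
end

section
/- Let (X, S, μ) be a probability space. For every ε > 0 there exists δ > 0 such that for every finite measurable partition Π of X and every measurable set C with H_μ(C | Π) > ε, one has μ(⋃{A ∈ Π : δ μ(A) ≤ μ(A ∩ C) ≤ (1−δ) μ(A)}) > δ. -/
open MeasureTheory Filter

/-- `P` is a finite measurable partition of `X`, all of whose cells have positive measure. -/
def IsFinPartition {X : Type*} [MeasurableSpace X] (μ : Measure X) (P : Finset (Set X)) : Prop :=
  (∀ A ∈ P, MeasurableSet A) ∧ (∀ A ∈ P, 0 < μ A) ∧
    ((P : Set (Set X)).PairwiseDisjoint id) ∧ ⋃₀ (P : Set (Set X)) = Set.univ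

/-- The conditional entropy (base 2) `H_μ(C | P) = H_μ({C, Cᶜ} | P)` of a set `C` given a
finite partition `P`. -/
noncomputable def condEntropy2 {X : Type*} [MeasurableSpace X] (μ : Measure X)
    (C : Set X) (P : Finset (Set X)) : ℝ :=
  -∑ A ∈ P, (μ A).toReal *
      (((μ (C ∩ A)).toReal / (μ A).toReal) * Real.logb 2 ((μ (C ∩ A)).toReal / (μ A).toReal) +
       ((μ (Cᶜ ∩ A)).toReal / (μ A).toReal) * Real.logb 2 ((μ (Cᶜ ∩ A)).toReal / (μ A).toReal))
/-- For every `ε > 0` there is a `δ > 0` such that for every finite measurable partition `P`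
and every measurable set `C` with `H_μ(C | P) > ε`, the union of those cells `A ∈ P` with
`δ μ(A) ≤ μ(A ∩ C) ≤ (1 − δ) μ(A)` has measure greater than `δ`. -/
theorem exists_delta_of_large_conditional_entropy
    {X : Type*} [MeasurableSpace X] (μ : Measure X) [IsProbabilityMeasure μ] :
    ∀ ε > (0 : ℝ), ∃ δ > (0 : ℝ),
      ∀ P : Finset (Set X), IsFinPartition μ P →
        ∀ C : Set X, MeasurableSet C → condEntropy2 μ C P > ε →
          (μ (⋃₀ {A : Set X | A ∈ P ∧ δ * (μ A).toReal ≤ (μ (A ∩ C)).toReal ∧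
            (μ (A ∩ C)).toReal ≤ (1 - δ) * (μ A).toReal})).toReal > δ := by
  classical
  intro ε hε
  have hl2 : 0 < Real.log 2 := Real.log_pos (by norm_num)
  obtain ⟨η, hη, hη'⟩ := Metric.continuousAt_iff.1
    (Real.binEntropy_continuous.continuousAt (x := 0)) (ε / 2 * Real.log 2) (by positivity)
  have hη2 : ∀ p : ℝ, 0 ≤ p → p < η → Real.binEntropy p ≤ ε / 2 * Real.log 2 := by
    intro p hp0 hp
    have := hη' (x := p) (by simpa [Real.dist_eq, abs_of_nonneg hp0] using hp)
    simp only [Real.dist_eq, Real.binEntropy_zero, sub_zero] at this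
    exact (le_abs_self _).trans this.le
  refine ⟨min η (ε / 2), lt_min hη (by positivity), ?_⟩
  set δ := min η (ε / 2) with hδ
  have hδη : δ ≤ η := min_le_left _ _
  have hδε : δ ≤ ε / 2 := min_le_right _ _
  rintro P ⟨hm, hpos, hdisj, huniv⟩ C hC hH
  by_contra hcon
  have hcon := not_lt.1 hcon
  obtain ⟨Q, hQ⟩ : ∃ Q : Set X → Prop, Q = fun A => δ * (μ A).toReal ≤ (μ (A ∩ C)).toReal ∧
            (μ (A ∩ C)).toReal ≤ (1 - δ) * (μ A).toReal := ⟨_, rfl⟩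
  have hU : ∀ S : Finset (Set X), S ⊆ P →
      (μ (⋃₀ (S : Set (Set X)))).toReal = ∑ A ∈ S, (μ A).toReal := by
    intro S hS
    rw [Set.sUnion_eq_biUnion]
    have := measure_biUnion_finset (μ := μ) (s := S) (f := id)
      (hdisj.subset (by exact_mod_cast hS)) (fun A hA => hm A (hS hA))
    simp only [id, Finset.mem_coe] at this ⊢
    rw [this, ENNReal.toReal_sum (fun A _ => measure_ne_top μ A)]
  have hsum : ∑ A ∈ P, (μ A).toReal = 1 := by
    rw [← hU P subset_rfl, huniv]; simp
  have hsumQ : ∑ A ∈ P.filter Q, (μ A).toReal ≤ δ := by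
    rw [← hU _ (Finset.filter_subset _ _)]
    simpa [hQ] using hcon
  have key : ∀ A ∈ P, -((μ A).toReal *
      (((μ (C ∩ A)).toReal / (μ A).toReal) * Real.logb 2 ((μ (C ∩ A)).toReal / (μ A).toReal) +
       ((μ (Cᶜ ∩ A)).toReal / (μ A).toReal) * Real.logb 2 ((μ (Cᶜ ∩ A)).toReal / (μ A).toReal)))
       ≤ (if Q A then (μ A).toReal else 0) + ε / 2 * (μ A).toReal := by
    intro A hA
    have ha : 0 < (μ A).toReal := ENNReal.toReal_pos (hpos A hA).ne' (measure_ne_top _ _)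
    have hadd : (μ (C ∩ A)).toReal + (μ (Cᶜ ∩ A)).toReal = (μ A).toReal := by
      rw [← ENNReal.toReal_add (measure_ne_top _ _) (measure_ne_top _ _)]
      congr 1
      have := measure_inter_add_sdiff (μ := μ) A hC
      rw [Set.inter_comm C, Set.inter_comm Cᶜ, ← Set.sdiff_eq]; exact this
    have hc0 : 0 ≤ (μ (C ∩ A)).toReal := ENNReal.toReal_nonneg
    have hc1 : 0 ≤ (μ (Cᶜ ∩ A)).toReal := ENNReal.toReal_nonneg
    have hQA : Q A ↔ δ * (μ A).toReal ≤ (μ (C ∩ A)).toReal ∧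
            (μ (C ∩ A)).toReal ≤ (1 - δ) * (μ A).toReal := by
      simp only [hQ, Set.inter_comm C]
    generalize (μ A).toReal = a at *
    generalize (μ (C ∩ A)).toReal = c at *
    have hd : (μ (Cᶜ ∩ A)).toReal / a = 1 - c / a := by
      field_simp; linarith
    have hp0 : 0 ≤ c / a := by positivity
    have hp1 : 0 ≤ 1 - c / a := by rw [← hd]; positivity
    rw [hd]
    have hca : c = c / a * a := by field_simp
    generalize c / a = p at *
    have hE : -(a * (p * Real.logb 2 p + (1 - p) * Real.logb 2 (1 - p)))
        = a * (Real.binEntropy p / Real.log 2) := by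
      rw [Real.binEntropy, Real.log_inv, Real.log_inv, Real.logb, Real.logb]; ring
    rw [hE]
    by_cases h : Q A
    · rw [if_pos h]
      have : Real.binEntropy p / Real.log 2 ≤ 1 := by
        rw [div_le_one hl2]; exact Real.binEntropy_le_log_two
      nlinarith
    · rw [if_neg h]
      have : Real.binEntropy p / Real.log 2 ≤ ε / 2 := by
        rw [div_le_iff₀ hl2]
        rw [hQA, not_and_or, not_le, not_le, hca] at h
        rcases h with h | h
        · exact hη2 p hp0 ((lt_of_mul_lt_mul_right h ha.le).trans_le hδη)
        · rw [← Real.binEntropy_one_sub]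
          have := lt_of_mul_lt_mul_right h ha.le
          exact hη2 _ hp1 (by linarith)
      nlinarith
  have h1 := Finset.sum_le_sum key
  rw [Finset.sum_neg_distrib, Finset.sum_add_distrib, ← Finset.mul_sum, hsum,
    ← Finset.sum_filter] at h1
  unfold condEntropy2 at hH
  linarith
end

section
/- Let (X, S, μ) be a probability space. For every ε > 0 there exists δ > 0 such that for every finite measurable partition Π of X and every measurable set C with H_μ(C | Π) < δ, there is a subcollection Π₀ ⊂ Π (depending on C) such that μ((⋃Π₀) △ C) < ε. -/
open MeasureTheory Filter
open scoped symmDiff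

theorem aux_ent {p q : ℝ} (hp : 0 ≤ p) (hq : 0 ≤ q) (hpq : p + q = 1) (h : p ≤ 1 / 2) :
    p ≤ -(p * Real.logb 2 p + q * Real.logb 2 q) := by
  have h2 : q * Real.logb 2 q ≤ 0 :=
    mul_nonpos_of_nonneg_of_nonpos hq (Real.logb_nonpos (by norm_num) hq (by linarith))
  rcases hp.eq_or_lt with h0 | h0
  · subst h0; simp at *; linarith
  · have h1 : Real.logb 2 p ≤ -1 := by
      rw [Real.logb_le_iff_le_rpow (by norm_num) h0, Real.rpow_neg_one]
      linarith
    nlinarith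

theorem approx_by_cells_of_small_conditional_entropy
    {X : Type*} [MeasurableSpace X] (μ : Measure X) [IsProbabilityMeasure μ] :
    ∀ ε > (0 : ℝ), ∃ δ > (0 : ℝ),
      ∀ P : Finset (Set X), IsFinPartition μ P →
        ∀ C : Set X, MeasurableSet C → condEntropy2 μ C P < δ →
          ∃ P₀ ⊆ P, (μ ((⋃₀ (P₀ : Set (Set X))) ∆ C)).toReal < ε := by
  classical
  intro ε hε
  refine ⟨ε, hε, fun P hP C hC hH => ?_⟩
  obtain ⟨-, hpos, -, hU⟩ := hP
  refine ⟨P.filter (fun A => (μ (Cᶜ ∩ A)).toReal / (μ A).toReal ≤ 1 / 2),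
    Finset.filter_subset _ _, ?_⟩
  refine lt_of_le_of_lt ?_ hH
  set D : Set X → Set X := fun A =>
    if (μ (Cᶜ ∩ A)).toReal / (μ A).toReal ≤ 1 / 2 then Cᶜ ∩ A else C ∩ A with hD
  have hsub : ((⋃₀ ((P.filter (fun A => (μ (Cᶜ ∩ A)).toReal / (μ A).toReal ≤ 1 / 2) :
      Finset (Set X)) : Set (Set X))) ∆ C) ⊆ ⋃ A ∈ P, D A := by
    rintro x (⟨⟨A, hA, hxA⟩, hxC⟩ | ⟨hxC, hx⟩)
    · have hA' := Finset.mem_filter.1 (Finset.mem_coe.1 hA)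
      refine Set.mem_iUnion₂.2 ⟨A, hA'.1, ?_⟩
      simp only [hD]
      rw [if_pos hA'.2]
      exact ⟨hxC, hxA⟩
    · have : x ∈ ⋃₀ (P : Set (Set X)) := hU ▸ Set.mem_univ x
      obtain ⟨A, hA, hxA⟩ := this
      refine Set.mem_iUnion₂.2 ⟨A, hA, ?_⟩
      simp only [hD]
      rw [if_neg]
      · exact ⟨hxC, hxA⟩
      · intro hle
        exact hx ⟨A, Finset.mem_coe.2 (Finset.mem_filter.2 ⟨hA, hle⟩), hxA⟩
  have h1 : μ.real ((⋃₀ ((P.filter (fun A => (μ (Cᶜ ∩ A)).toReal / (μ A).toReal ≤ 1 / 2) :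
      Finset (Set X)) : Set (Set X))) ∆ C) ≤ ∑ A ∈ P, μ.real (D A) :=
    (measureReal_mono hsub (measure_ne_top _ _)).trans (measureReal_biUnion_finset_le P D)
  refine h1.trans ?_
  unfold condEntropy2
  rw [← Finset.sum_neg_distrib]
  refine Finset.sum_le_sum fun A hA => ?_
  have ha : 0 < (μ A).toReal := ENNReal.toReal_pos (hpos A hA).ne' (measure_ne_top _ _)
  have hadd : (μ (C ∩ A)).toReal + (μ (Cᶜ ∩ A)).toReal = (μ A).toReal := by
    have := measureReal_inter_add_sdiff (μ := μ) (s := A) hC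
    rw [Set.sdiff_eq, Set.inter_comm A C, Set.inter_comm A Cᶜ] at this
    exact this
  have hsum : (μ (C ∩ A)).toReal / (μ A).toReal + (μ (Cᶜ ∩ A)).toReal / (μ A).toReal = 1 := by
    rw [← add_div, hadd, div_self ha.ne']
  have hp : 0 ≤ (μ (C ∩ A)).toReal / (μ A).toReal := by positivity
  have hq : 0 ≤ (μ (Cᶜ ∩ A)).toReal / (μ A).toReal := by positivity
  have e1 : (μ (C ∩ A)).toReal = (μ A).toReal * ((μ (C ∩ A)).toReal / (μ A).toReal) := by
    field_simp
  have e2 : (μ (Cᶜ ∩ A)).toReal = (μ A).toReal * ((μ (Cᶜ ∩ A)).toReal / (μ A).toReal) := by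
    field_simp
  rw [← mul_neg]
  simp only [hD]
  split_ifs with h
  · refine (le_of_eq e2).trans (mul_le_mul_of_nonneg_left ?_ ha.le)
    rw [add_comm]
    exact aux_ent hq hp (by linarith) h
  · refine (le_of_eq e1).trans (mul_le_mul_of_nonneg_left ?_ ha.le)
    exact aux_ent hp hq hsum (by linarith)
end

section
/- Let (X, S, μ) be a probability space and C ⊆ S a family of measurable subsets of X. Then H_μ(C) = 0 if and only if for every δ > 0 there exists a finite measurable partition Π of X such that H_μ(C | Π) ≤ δ for all C ∈ C. -/
open MeasureTheory Filter

namespace ZE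

noncomputable def h (a b : ℝ) : ℝ := Real.negMulLog a + Real.negMulLog b - Real.negMulLog (a + b)

lemma h_zero : h 0 0 = 0 := by simp [h]

lemma gibbs1 {a t q : ℝ} (ha : 0 ≤ a) (hat : a ≤ t) (hq : 0 ≤ q) (hqa : q = 0 → a = 0) :
    Real.negMulLog a + a * Real.log t ≤ -(a * Real.log q) + (q * t - a) := by
  rcases ha.eq_or_lt with h0 | h0
  · subst h0; simp; positivity
  · have ht : 0 < t := by linarith
    have hq0 : 0 < q := lt_of_le_of_ne hq (fun hh => by have := hqa hh.symm; linarith)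
    have h1 := Real.log_le_sub_one_of_pos (x := q * t / a) (by positivity)
    rw [Real.log_div (by positivity) (by positivity), Real.log_mul (by positivity) (by positivity)] at h1
    have h2 := mul_le_mul_of_nonneg_left h1 ha
    have h3 : a * (q * t / a - 1) = q * t - a := by field_simp
    rw [h3] at h2
    simp only [Real.negMulLog]
    linarith

lemma gibbs {a b q : ℝ} (ha : 0 ≤ a) (hb : 0 ≤ b) (hq : 0 ≤ q) (hq1 : 0 ≤ 1 - q)
    (hqa : q = 0 → a = 0) (hqb : 1 - q = 0 → b = 0) :
    h a b ≤ -(a * Real.log q) - b * Real.log (1 - q) := by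
  have h1 := gibbs1 ha (by linarith : a ≤ a + b) hq hqa
  have h2 := gibbs1 hb (by linarith : b ≤ a + b) hq1 hqb
  simp only [h]
  have : Real.negMulLog (a + b) = -(a * Real.log (a+b)) - b * Real.log (a+b) := by
    simp only [Real.negMulLog]; ring
  rw [this]; linarith

lemma h_le {a b : ℝ} (ha : 0 ≤ a) (hb : 0 ≤ b) : h a b ≤ (a + b) * Real.log 2 := by
  have := gibbs (q := 1/2) ha hb (by norm_num) (by norm_num) (by norm_num) (by norm_num)
  have e : (1:ℝ) - 1/2 = 1/2 := by norm_num
  rw [e, one_div, Real.log_inv] at this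
  linarith

lemma h_eq {a b : ℝ} (ha : 0 ≤ a) (hb : 0 ≤ b) :
    h a b = -(a * Real.log (a / (a + b))) - b * Real.log (b / (a + b)) := by
  simp only [h, Real.negMulLog]
  rcases ha.eq_or_lt with h0 | h0
  · subst h0
    rcases hb.eq_or_lt with h1 | h1
    · subst h1; simp
    · simp [h1.ne']
  · rcases hb.eq_or_lt with h1 | h1
    · subst h1; simp [h0.ne']
    · rw [Real.log_div (by positivity) (by positivity), Real.log_div (by positivity) (by positivity)]
      ring

lemma h_sum {ι : Type*} (s : Finset ι) (a b : ι → ℝ) (ha : ∀ i ∈ s, 0 ≤ a i) (hb : ∀ i ∈ s, 0 ≤ b i) :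
    ∑ i ∈ s, h (a i) (b i) ≤ h (∑ i ∈ s, a i) (∑ i ∈ s, b i) := by
  set A := ∑ i ∈ s, a i with hA
  set B := ∑ i ∈ s, b i with hB
  have hA0 : 0 ≤ A := Finset.sum_nonneg ha
  have hB0 : 0 ≤ B := Finset.sum_nonneg hb
  have ha' : A = 0 → ∀ i ∈ s, a i = 0 := (Finset.sum_eq_zero_iff_of_nonneg ha).1
  have hb' : B = 0 → ∀ i ∈ s, b i = 0 := (Finset.sum_eq_zero_iff_of_nonneg hb).1
  by_cases hAB : A + B = 0
  · have e1 : A = 0 := by linarith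
    have e2 : B = 0 := by linarith
    rw [Finset.sum_eq_zero]
    · rw [e1, e2, h_zero]
    · intro i hi; rw [ha' e1 i hi, hb' e2 i hi, h_zero]
  · have hpos : 0 < A + B := lt_of_le_of_ne (by positivity) (Ne.symm hAB)
    have e : 1 - A / (A + B) = B / (A + B) := by field_simp; ring
    calc ∑ i ∈ s, h (a i) (b i)
        ≤ ∑ i ∈ s, (-(a i * Real.log (A / (A + B))) - b i * Real.log (B / (A + B))) := by
          apply Finset.sum_le_sum
          intro i hi
          have := gibbs (q := A / (A + B)) (ha i hi) (hb i hi) (by positivity)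
            (by rw [e]; positivity)
            (fun hh => ha' ((div_eq_zero_iff.1 hh).resolve_right hAB) i hi)
            (fun hh => hb' ((div_eq_zero_iff.1 (e ▸ hh)).resolve_right hAB) i hi)
          rwa [e] at this
      _ = h A B := by
          rw [h_eq hA0 hB0, Finset.sum_sub_distrib, Finset.sum_neg_distrib, ← Finset.sum_mul,
            ← Finset.sum_mul]

lemma eta_sub {ι : Type*} (s : Finset ι) (a : ι → ℝ) (ha : ∀ i ∈ s, 0 ≤ a i) :
    Real.negMulLog (∑ i ∈ s, a i) ≤ ∑ i ∈ s, Real.negMulLog (a i) := by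
  have : Real.negMulLog (∑ i ∈ s, a i) = ∑ i ∈ s, -(a i * Real.log (∑ j ∈ s, a j)) := by
    rw [Finset.sum_neg_distrib, ← Finset.sum_mul, Real.negMulLog]; ring
  rw [this]
  apply Finset.sum_le_sum
  intro i hi
  rcases (ha i hi).eq_or_lt with h0 | h0
  · simp [← h0]
  · have h1 : Real.log (a i) ≤ Real.log (∑ j ∈ s, a j) :=
      Real.log_le_log h0 (Finset.single_le_sum ha hi)
    have := mul_le_mul_of_nonneg_left h1 h0.le
    simp only [Real.negMulLog]; linarith

variable {X : Type*}

def cell (S : ℕ → Set X) (n : ℕ) (s : Fin n → Bool) : Set X :=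
  ⋂ i : Fin n, if s i then S i else (S i)ᶜ

lemma cell_snoc (S : ℕ → Set X) (n : ℕ) (s : Fin n → Bool) (b : Bool) :
    cell S (n+1) (Fin.snoc s b : Fin (n+1) → Bool) = (if b then S n else (S n)ᶜ) ∩ cell S n s := by
  ext x
  simp only [cell, Set.mem_iInter, Set.mem_inter_iff]
  constructor
  · intro H
    refine ⟨by simpa using H (Fin.last n), fun i => by simpa using H i.castSucc⟩
  · rintro ⟨h1, h2⟩ i
    refine Fin.lastCases ?_ (fun j => ?_) i
    · simpa using h1
    · simpa using h2 j

lemma cell_zero (S : ℕ → Set X) (s : Fin 0 → Bool) : cell S 0 s = Set.univ := by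
  simp [cell]

lemma cell_disj (S : ℕ → Set X) (n : ℕ) {s t : Fin n → Bool} (hst : s ≠ t) :
    Disjoint (cell S n s) (cell S n t) := by
  obtain ⟨i, hi⟩ := Function.ne_iff.1 hst
  rw [Set.disjoint_left]
  intro x hx hy
  have h1 := Set.mem_iInter.1 hx i
  have h2 := Set.mem_iInter.1 hy i
  cases h3 : s i <;> cases h4 : t i <;> simp_all

lemma cell_cover (S : ℕ → Set X) (n : ℕ) : ⋃ s, cell S n s = Set.univ := by
  classical
  ext x
  simp only [Set.mem_iUnion, Set.mem_univ, iff_true]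
  refine ⟨fun i => decide (x ∈ S i), ?_⟩
  simp only [cell, Set.mem_iInter]
  intro i
  by_cases hx : x ∈ S i <;> simp [hx]

variable [MeasurableSpace X]

lemma cell_meas (S : ℕ → Set X) (hS : ∀ i, MeasurableSet (S i)) (n : ℕ) (s : Fin n → Bool) :
    MeasurableSet (cell S n s) := by
  refine MeasurableSet.iInter fun i => ?_
  split_ifs
  · exact hS i
  · exact (hS i).compl

variable (μ : Measure X) [IsProbabilityMeasure μ]

lemma sum_step (S : ℕ → Set X) (n : ℕ) (B : Set X) (φ : ℝ → ℝ) :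
    ∑ s, φ (μ.real (B ∩ cell S (n+1) s)) =
      ∑ s, (φ (μ.real (S n ∩ (B ∩ cell S n s))) + φ (μ.real ((S n)ᶜ ∩ (B ∩ cell S n s)))) := by
  rw [← (Fin.snocEquiv (fun _ : Fin (n+1) => Bool)).sum_comp, Fintype.sum_prod_type, Finset.sum_comm]
  refine Finset.sum_congr rfl fun s _ => ?_
  simp only [Fin.snocEquiv, Equiv.coe_fn_mk, Fintype.sum_bool]
  rw [cell_snoc, cell_snoc]
  simp [Set.inter_left_comm]

lemma split (D B : Set X) (hD : MeasurableSet D) :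
    μ.real (D ∩ B) + μ.real (Dᶜ ∩ B) = μ.real B := by
  rw [Set.inter_comm D, Set.inter_comm Dᶜ, ← Set.sdiff_eq]
  exact measureReal_inter_add_sdiff hD

lemma sum_mass (S : ℕ → Set X) (hS : ∀ i, MeasurableSet (S i)) (n : ℕ) (B : Set X) :
    ∑ s, μ.real (B ∩ cell S n s) = μ.real B := by
  induction n with
  | zero => simp [cell_zero]
  | succ n ih =>
    rw [sum_step μ S n B (fun x => x), ← ih]
    exact Finset.sum_congr rfl fun s _ => split μ _ _ (hS n)

noncomputable def G (S : ℕ → Set X) (B : Set X) (n : ℕ) : ℝ :=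
  ∑ s, Real.negMulLog (μ.real (B ∩ cell S n s))

lemma G_step (S : ℕ → Set X) (hS : ∀ i, MeasurableSet (S i)) (n : ℕ) (B : Set X) :
    G μ S B (n+1) = G μ S B n +
      ∑ s, h (μ.real (S n ∩ (B ∩ cell S n s))) (μ.real ((S n)ᶜ ∩ (B ∩ cell S n s))) := by
  rw [G, sum_step, G, ← Finset.sum_add_distrib]
  refine Finset.sum_congr rfl fun s _ => ?_
  rw [h, split μ _ _ (hS n)]; ring

lemma G_step_le (S : ℕ → Set X) (hS : ∀ i, MeasurableSet (S i)) (n : ℕ) (B : Set X) :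
    G μ S B (n+1) ≤ G μ S B n + h (μ.real (S n ∩ B)) (μ.real ((S n)ᶜ ∩ B)) := by
  rw [G_step μ S hS]
  have := h_sum Finset.univ (fun s => μ.real (S n ∩ (B ∩ cell S n s)))
    (fun s => μ.real ((S n)ᶜ ∩ (B ∩ cell S n s))) (fun _ _ => measureReal_nonneg)
    (fun _ _ => measureReal_nonneg)
  simp only [← Set.inter_assoc] at this ⊢
  rw [sum_mass μ S hS, sum_mass μ S hS] at this
  linarith

lemma G_zero (S : ℕ → Set X) (B : Set X) : G μ S B 0 = Real.negMulLog (μ.real B) := by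
  simp [G, cell_zero]

lemma joinEntropy_eq (S : ℕ → Set X) (n : ℕ) :
    joinEntropy μ (fun i : Fin n => S i) = G μ S Set.univ n / Real.log 2 := by
  simp only [joinEntropy, G, Finset.sum_div, Set.univ_inter]
  refine Finset.sum_congr rfl fun s _ => ?_
  simp only [Real.negMulLog, Real.logb, cell, Measure.real]
  ring

lemma cond_eq (D : Set X) (hD : MeasurableSet D) (P : Finset (Set X)) :
    condEntropy2 μ D P = (∑ A ∈ P, h (μ.real (D ∩ A)) (μ.real (Dᶜ ∩ A))) / Real.log 2 := by
  simp only [condEntropy2, Finset.sum_div, ← Finset.sum_neg_distrib]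
  refine Finset.sum_congr rfl fun A _ => ?_
  rw [h_eq measureReal_nonneg measureReal_nonneg, split μ _ _ hD]
  simp only [Measure.real, Real.logb]
  by_cases h0 : (μ A).toReal = 0
  · simp [h0]
  · field_simp
    ring

lemma G_univ_nonneg (S : ℕ → Set X) (n : ℕ) : 0 ≤ G μ S Set.univ n :=
  Finset.sum_nonneg fun _ _ => Real.negMulLog_nonneg measureReal_nonneg measureReal_le_one

lemma G_univ_le (S : ℕ → Set X) (hS : ∀ i, MeasurableSet (S i)) (n : ℕ) :
    G μ S Set.univ n ≤ n * Real.log 2 := by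
  induction n with
  | zero => simp [G_zero]
  | succ n ih =>
    have h1 := G_step_le μ S hS n Set.univ
    have h2 := h_le (a := μ.real (S n ∩ Set.univ)) (b := μ.real ((S n)ᶜ ∩ Set.univ))
      measureReal_nonneg measureReal_nonneg
    rw [split μ _ _ (hS n)] at h2
    simp at h2 h1
    push_cast; linarith

lemma joinE_nonneg (S : ℕ → Set X) (n : ℕ) :
    0 ≤ joinEntropy μ (fun i : Fin n => S i) / n := by
  rw [joinEntropy_eq]
  have := G_univ_nonneg μ S n
  have := Real.log_pos (by norm_num : (1:ℝ) < 2)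
  positivity

lemma joinE_le (S : ℕ → Set X) (hS : ∀ i, MeasurableSet (S i)) (n : ℕ) :
    joinEntropy μ (fun i : Fin n => S i) / n ≤ 1 := by
  rw [joinEntropy_eq]
  have h1 := G_univ_le μ S hS n
  have := Real.log_pos (by norm_num : (1:ℝ) < 2)
  apply div_le_one_of_le₀ _ (by positivity)
  rwa [div_le_iff₀ this]

lemma bdd_le (S : ℕ → Set X) (hS : ∀ i, MeasurableSet (S i)) :
    IsBoundedUnder (· ≤ ·) atTop (fun n : ℕ => joinEntropy μ (fun i : Fin n => S i) / n) :=
  isBoundedUnder_of ⟨1, joinE_le μ S hS⟩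

lemma bdd_ge (S : ℕ → Set X) :
    IsBoundedUnder (· ≥ ·) atTop (fun n : ℕ => joinEntropy μ (fun i : Fin n => S i) / n) :=
  isBoundedUnder_of ⟨0, joinE_nonneg μ S⟩

lemma G_le_part (S : ℕ → Set X) (hS : ∀ i, MeasurableSet (S i)) (P : Finset (Set X))
    (hP : IsFinPartition μ P) (n : ℕ) : G μ S Set.univ n ≤ ∑ A ∈ P, G μ S A n := by
  unfold G
  rw [Finset.sum_comm]
  refine Finset.sum_le_sum fun s _ => ?_
  have : μ.real (Set.univ ∩ cell S n s) = ∑ A ∈ P, μ.real (A ∩ cell S n s) := by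
    rw [← hP.2.2.2, Set.sUnion_eq_biUnion, Set.iUnion₂_inter]
    exact measureReal_biUnion_finset
      (fun A hA B hB hAB => (hP.2.2.1 hA hB hAB).mono Set.inter_subset_left Set.inter_subset_left)
      (fun A hA => (hP.1 A hA).inter (cell_meas S hS n s))
  rw [this]
  exact eta_sub _ _ fun _ _ => measureReal_nonneg

lemma sum_G_le (S : ℕ → Set X) (hS : ∀ i, MeasurableSet (S i)) (P : Finset (Set X)) (δ : ℝ)
    (hδ : ∀ i, condEntropy2 μ (S i) P ≤ δ) (n : ℕ) :
    ∑ A ∈ P, G μ S A n ≤ ∑ A ∈ P, G μ S A 0 + n * (δ * Real.log 2) := by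
  induction n with
  | zero => simp
  | succ n ih =>
    have h1 : ∑ A ∈ P, G μ S A (n+1) ≤
        ∑ A ∈ P, (G μ S A n + h (μ.real (S n ∩ A)) (μ.real ((S n)ᶜ ∩ A))) :=
      Finset.sum_le_sum fun A _ => G_step_le μ S hS n A
    rw [Finset.sum_add_distrib] at h1
    have h2 := hδ n
    rw [cond_eq μ _ (hS n), div_le_iff₀ (Real.log_pos (by norm_num : (1:ℝ) < 2))] at h2
    push_cast; linarith

lemma liminf_le (S : ℕ → Set X) (hS : ∀ i, MeasurableSet (S i)) (P : Finset (Set X))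
    (hP : IsFinPartition μ P) (δ : ℝ) (hδ : ∀ i, condEntropy2 μ (S i) P ≤ δ) :
    liminf (fun n : ℕ => joinEntropy μ (fun i : Fin n => S i) / n) atTop ≤ δ := by
  have hl := Real.log_pos (by norm_num : (1:ℝ) < 2)
  set K := (∑ A ∈ P, G μ S A 0) / Real.log 2 with hK
  have ht : Tendsto (fun n : ℕ => K / n + δ) atTop (nhds δ) := by
    simpa using (tendsto_const_div_atTop_nhds_zero_nat K).add_const δ
  rw [← ht.liminf_eq]
  apply liminf_le_liminf _ (bdd_ge μ S) ht.isBoundedUnder_le.isCoboundedUnder_ge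
  filter_upwards [eventually_gt_atTop 0] with n hn
  have hn' : (0:ℝ) < n := by exact_mod_cast hn
  have h1 := (G_le_part μ S hS P hP n).trans (sum_G_le μ S hS P δ hδ n)
  rw [joinEntropy_eq, div_le_iff₀ hn', div_le_iff₀ hl]
  have : (K / n + δ) * n * Real.log 2 = ∑ A ∈ P, G μ S A 0 + n * (δ * Real.log 2) := by
    rw [hK]; field_simp
  linarith

/-- Merge null cells. -/
lemma exists_part {ι : Type*} [Fintype ι] (A : ι → Set X) (hA : ∀ i, MeasurableSet (A i))
    (hd : ∀ i j, i ≠ j → Disjoint (A i) (A j)) (hc : ⋃ i, A i = Set.univ) :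
    ∃ P : Finset (Set X), IsFinPartition μ P ∧ ∀ D : Set X,
      ∑ B ∈ P, h (μ.real (D ∩ B)) (μ.real (Dᶜ ∩ B)) =
        ∑ i, h (μ.real (D ∩ A i)) (μ.real (Dᶜ ∩ A i)) := by
  classical
  have hex : ∃ i, μ (A i) ≠ 0 := by
    by_contra! hcon
    have : μ (⋃ i, A i) = 0 := measure_iUnion_null hcon
    rw [hc] at this; simp at this
  obtain ⟨i0, hi0⟩ := hex
  let N : Set X := ⋃ i ∈ {i | μ (A i) = 0}, A i
  have hN : μ N = 0 := (measure_biUnion_null_iff (Set.to_countable _)).2 fun i hi => hi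
  have hNm : MeasurableSet N := MeasurableSet.biUnion (Set.to_countable _) fun i _ => hA i
  have hNd : ∀ i, μ (A i) ≠ 0 → Disjoint (A i) N := by
    intro i hi
    simp only [N, Set.disjoint_iUnion_right]
    intro j hj
    exact hd i j (fun e => hi (e ▸ hj))
  let B : ι → Set X := fun i => if i = i0 then A i ∪ N else A i
  have hAB : ∀ i, A i ⊆ B i := by
    intro i; simp only [B]; split_ifs
    · exact Set.subset_union_left
    · exact subset_rfl
  have hBA : ∀ i, B i ⊆ A i ∪ N := by
    intro i; simp only [B]; split_ifs
    · exact subset_rfl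
    · exact Set.subset_union_left
  have hBd : ∀ i j, μ (A i) ≠ 0 → μ (A j) ≠ 0 → i ≠ j → Disjoint (B i) (B j) := by
    intro i j hi hj hij
    simp only [B]
    split_ifs with e1 e2 e2
    · exact absurd (e1.trans e2.symm) hij
    · exact Set.disjoint_union_left.2 ⟨hd i j hij, (hNd j hj).symm⟩
    · exact Set.disjoint_union_right.2 ⟨hd i j hij, hNd i hi⟩
    · exact hd i j hij
  have hBm : ∀ D i, μ.real (D ∩ B i) = μ.real (D ∩ A i) := by
    intro D i
    apply le_antisymm
    · calc μ.real (D ∩ B i) ≤ μ.real ((D ∩ A i) ∪ N) := by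
            apply measureReal_mono
            · rintro x ⟨hx, hx2⟩
              rcases hBA i hx2 with h1 | h1
              · exact Or.inl ⟨hx, h1⟩
              · exact Or.inr h1
            · exact measure_ne_top _ _
        _ ≤ μ.real (D ∩ A i) + μ.real N := measureReal_union_le _ _
        _ = μ.real (D ∩ A i) := by simp [Measure.real, hN]
    · exact measureReal_mono (Set.inter_subset_inter_right _ (hAB i))
  refine ⟨(Finset.univ.filter fun i => μ (A i) ≠ 0).image B, ⟨?_, ?_, ?_, ?_⟩, ?_⟩
  · intro C hC
    obtain ⟨i, hi, rfl⟩ := Finset.mem_image.1 hC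
    simp only [B]; split_ifs
    · exact (hA i).union hNm
    · exact hA i
  · intro C hC
    obtain ⟨i, hi, rfl⟩ := Finset.mem_image.1 hC
    have hi' : μ (A i) ≠ 0 := by simpa using hi
    exact (pos_iff_ne_zero.2 hi').trans_le (measure_mono (hAB i))
  · intro C hC C' hC' hne
    obtain ⟨i, hi, rfl⟩ := Finset.mem_image.1 (Finset.mem_coe.1 hC)
    obtain ⟨j, hj, rfl⟩ := Finset.mem_image.1 (Finset.mem_coe.1 hC')
    exact hBd i j (by simpa using hi) (by simpa using hj) (fun e => hne (e ▸ rfl))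
  · rw [Set.eq_univ_iff_forall]
    intro x
    obtain ⟨i, hx⟩ := Set.mem_iUnion.1 (hc ▸ Set.mem_univ x : x ∈ ⋃ i, A i)
    by_cases hi : μ (A i) = 0
    · refine ⟨B i0, Finset.mem_coe.2 (Finset.mem_image_of_mem _ (by simpa using hi0)), ?_⟩
      simp only [B, if_true]
      exact Or.inr (Set.mem_biUnion (show i ∈ {i | μ (A i) = 0} from hi) hx)
    · exact ⟨B i, Finset.mem_coe.2 (Finset.mem_image_of_mem _ (by simpa using hi)), hAB i hx⟩
  · intro D
    rw [Finset.sum_image]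
    · simp only [hBm]
      rw [Finset.sum_filter]
      refine Finset.sum_congr rfl fun i _ => ?_
      split_ifs with hi
      · rfl
      · have hi' : μ (A i) = 0 := by simpa using hi
        have e : ∀ D, μ.real (D ∩ A i) = 0 := fun D => by
          simp [Measure.real, measure_mono_null (Set.inter_subset_right : D ∩ A i ⊆ A i) hi']
        rw [e, e, h_zero]
    · intro i hi j hj hij
      by_contra hne
      have hi' : μ (A i) ≠ 0 := by simpa using hi
      have := hBd i j hi' (by simpa using hj) hne
      rw [← hij, disjoint_self] at this
      have h2 := hAB i
      rw [this] at h2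
      exact hi' (measure_mono_null h2 (by simp))

noncomputable def seqOf {α : Type*} (F : ∀ n, (Fin n → α) → α) (n : ℕ) : α :=
  F n (fun i => seqOf F i.1)
termination_by n
decreasing_by exact i.2

lemma seqOf_eq {α : Type*} (F : ∀ n, (Fin n → α) → α) (n : ℕ) :
    seqOf F n = F n (fun i => seqOf F i.1) := by
  rw [seqOf]

lemma exists_seq (𝒞 : Set (Set X)) (h𝒞 : ∀ C ∈ 𝒞, MeasurableSet C) (δ : ℝ)
    (hδ : ∀ P : Finset (Set X), IsFinPartition μ P → ∃ C ∈ 𝒞, δ < condEntropy2 μ C P) :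
    ∃ S : ℕ → Set X, (∀ i, S i ∈ 𝒞) ∧ ∀ n, n * δ ≤ joinEntropy μ (fun i : Fin n => S i) := by
  have hl := Real.log_pos (by norm_num : (1:ℝ) < 2)
  have key : ∀ (n : ℕ) (c : Fin n → 𝒞), ∃ C : 𝒞, ∀ S : ℕ → Set X, (∀ i : Fin n, S i = c i) →
      δ * Real.log 2 ≤ ∑ s, h (μ.real (C.1 ∩ cell S n s)) (μ.real (C.1ᶜ ∩ cell S n s)) := by
    intro n c
    let S0 : ℕ → Set X := fun i => if hi : i < n then c ⟨i, hi⟩ else Set.univ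
    have hS0 : ∀ i, MeasurableSet (S0 i) := by
      intro i; simp only [S0]; split_ifs
      · exact h𝒞 _ (c _).2
      · exact MeasurableSet.univ
    obtain ⟨P, hP, hPe⟩ := exists_part μ (cell S0 n) (cell_meas S0 hS0 n)
      (fun i j hij => cell_disj S0 n hij) (cell_cover S0 n)
    obtain ⟨C, hC, hCP⟩ := hδ P hP
    refine ⟨⟨C, hC⟩, fun S hS => ?_⟩
    have e : cell S n = cell S0 n := by
      funext s
      simp only [cell]
      refine Set.iInter_congr fun i => ?_
      simp [S0, hS i]
    rw [e, ← hPe]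
    rw [cond_eq μ C (h𝒞 C hC), lt_div_iff₀ hl] at hCP
    exact hCP.le
  choose F hF using key
  let S : ℕ → Set X := fun n => (seqOf F n).1
  have hSm : ∀ i, MeasurableSet (S i) := fun i => h𝒞 _ (seqOf F i).2
  refine ⟨S, fun i => (seqOf F i).2, fun n => ?_⟩
  rw [joinEntropy_eq, le_div_iff₀ hl]
  induction n with
  | zero => simp [G_zero]
  | succ n ih =>
    rw [G_step μ S hSm]
    have h1 := hF n (fun i => seqOf F i.1) S (fun i => rfl)
    rw [← seqOf_eq F n] at h1
    simp only [Set.univ_inter]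
    push_cast
    change _ ≤ ∑ s, h (μ.real (S n ∩ cell S n s)) (μ.real ((S n)ᶜ ∩ cell S n s)) at h1
    linarith

end ZE

/-- `H_μ(𝒞) = 0` iff for each `δ > 0` there is a finite measurable partition `P` with
`H_μ(C | P) ≤ δ` for all `C ∈ 𝒞`. -/
theorem zero_entropy_iff_uniform_partition_approx
    {X : Type*} [MeasurableSpace X] (μ : Measure X) [IsProbabilityMeasure μ]
    (𝒞 : Set (Set X)) (h𝒞 : ∀ C ∈ 𝒞, MeasurableSet C) :
    famEntropy μ 𝒞 = 0 ↔
      ∀ δ > (0 : ℝ), ∃ P : Finset (Set X), IsFinPartition μ P ∧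
        ∀ C ∈ 𝒞, condEntropy2 μ C P ≤ δ := by
  constructor
  · intro H δ hδ
    by_contra! hcon
    obtain ⟨S, hS, hSn⟩ := ZE.exists_seq μ 𝒞 h𝒞 δ hcon
    have hSm : ∀ i, MeasurableSet (S i) := fun i => h𝒞 _ (hS i)
    have h1 : δ ≤ liminf (fun n : ℕ => joinEntropy μ (fun i : Fin n => S i) / n) atTop := by
      apply le_liminf_of_le (ZE.bdd_le μ S hSm).isCoboundedUnder_ge
      filter_upwards [eventually_gt_atTop 0] with n hn
      rw [le_div_iff₀ (by exact_mod_cast hn), mul_comm]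
      exact hSn n
    have hb : BddAbove (Set.range fun S : {f : ℕ → Set X // ∀ i, f i ∈ 𝒞} =>
        liminf (fun n : ℕ => joinEntropy μ (fun i : Fin n => S.1 i) / n) atTop) := by
      refine ⟨1, ?_⟩
      rintro _ ⟨T, rfl⟩
      exact liminf_le_of_frequently_le
        (Frequently.of_forall (ZE.joinE_le μ T.1 fun i => h𝒞 _ (T.2 i))) (ZE.bdd_ge μ T.1)
    have h2 : δ ≤ famEntropy μ 𝒞 := h1.trans (le_ciSup hb ⟨S, hS⟩)
    linarith
  · intro H
    apply le_antisymm
    · apply Real.iSup_le _ le_rfl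
      intro T
      apply le_of_forall_pos_le_add
      intro δ hδ
      obtain ⟨P, hP, hPC⟩ := H δ hδ
      rw [zero_add]
      exact ZE.liminf_le μ T.1 (fun i => h𝒞 _ (T.2 i)) P hP δ fun i => hPC _ (T.2 i)
    · apply Real.iSup_nonneg
      intro T
      exact le_liminf_of_le (ZE.bdd_le μ T.1 fun i => h𝒞 _ (T.2 i)).isCoboundedUnder_ge
        (Eventually.of_forall (ZE.joinE_nonneg μ T.1))
end

section
/- Let (X, S, μ) be a probability space, fix k ≥ 1, and let f_n : S^k → ℝ, n ≥ 1, be a sequence of functions that is uniformly continuous with respect to μ and satisfies lim_{n→∞} f_n(A_1, …, A_k) = 0 for all A_1, …, A_k ∈ S. If C ⊆ S is a family of measurable sets with H_μ(C) = 0, then lim_{n→∞} sup_{C_1, …, C_k ∈ C} f_n(C_1, …, C_k) = 0. -/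
open MeasureTheory Filter

open scoped symmDiff

/-- Signed cell of the join. -/
def zeCell {X : Type*} {n : ℕ} (C : Fin n → Set X) (s : Fin n → Bool) : Set X :=
  ⋂ i, if s i then C i else (C i)ᶜ

lemma zeCell_meas {X : Type*} [MeasurableSpace X] {n : ℕ} {C : Fin n → Set X}
    (hC : ∀ i, MeasurableSet (C i)) (s : Fin n → Bool) : MeasurableSet (zeCell C s) := by
  refine MeasurableSet.iInter fun i => ?_
  split_ifs
  · exact hC i
  · exact (hC i).compl

lemma zeCell_snoc {X : Type*} {n : ℕ} (D : Fin n → Set X) (C : Set X) (s : Fin n → Bool)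
    (b : Bool) : zeCell (Fin.snoc D C : Fin (n + 1) → Set X) (Fin.snoc s b : Fin (n+1) → Bool) =
      zeCell D s ∩ (if b then C else Cᶜ) := by
  ext x
  simp only [zeCell, Set.mem_iInter, Set.mem_inter_iff, Fin.forall_fin_succ', Fin.snoc_castSucc,
    Fin.snoc_last]

noncomputable def zePhi (x : ℝ) : ℝ := -(x * Real.logb 2 x)

lemma zePhi_eq (x : ℝ) : zePhi x = Real.negMulLog x / Real.log 2 := by
  simp only [zePhi, Real.negMulLog, Real.logb]; ring

lemma zePhi_lower_aux {a b : ℝ} (ha : 0 ≤ a) (hab : a ≤ b) :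
    a ≤ zePhi a + zePhi b - zePhi (a + b) := by
  have h2 : 0 < Real.log 2 := Real.log_pos (by norm_num)
  rw [zePhi_eq, zePhi_eq, zePhi_eq, ← add_div, ← sub_div, le_div_iff₀ h2]
  rcases ha.eq_or_lt with rfl | ha
  · simp
  have hb : 0 < b := ha.trans_le hab
  have h1 : Real.log 2 + Real.log a ≤ Real.log (a + b) := by
    rw [← Real.log_mul (by norm_num) ha.ne']
    exact Real.log_le_log (by positivity) (by linarith)
  have h3 : Real.log b ≤ Real.log (a + b) := Real.log_le_log hb (by linarith)
  simp only [Real.negMulLog]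
  nlinarith [mul_le_mul_of_nonneg_left h1 ha.le, mul_le_mul_of_nonneg_left h3 hb.le]

lemma zePhi_lower {a b : ℝ} (ha : 0 ≤ a) (hb : 0 ≤ b) :
    min a b ≤ zePhi a + zePhi b - zePhi (a + b) := by
  rcases le_total a b with h | h
  · rw [min_eq_left h]; exact zePhi_lower_aux ha h
  · rw [min_eq_right h, add_comm a b]
    have := zePhi_lower_aux hb h
    linarith

lemma zePhi_upper {a b : ℝ} (ha : 0 ≤ a) (hb : 0 ≤ b) :
    zePhi a + zePhi b - zePhi (a + b) ≤ a + b := by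
  have h2 : 0 < Real.log 2 := Real.log_pos (by norm_num)
  rw [zePhi_eq, zePhi_eq, zePhi_eq, ← add_div, ← sub_div, div_le_iff₀ h2]
  rcases (add_nonneg ha hb).eq_or_lt with h0 | h0
  · have : a = 0 := by linarith
    have : b = 0 := by linarith
    subst_vars; simp
  have h := (Real.concaveOn_negMulLog).2 (Set.mem_Ici.2 ha) (Set.mem_Ici.2 hb)
    (show (0:ℝ) ≤ 1/2 by norm_num) (show (0:ℝ) ≤ 1/2 by norm_num)
    (by norm_num)
  simp only [smul_eq_mul] at h
  have e : (1/2 * a + 1/2 * b : ℝ) = (a + b) / 2 := by ring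
  rw [e] at h
  have e2 : Real.negMulLog ((a+b)/2) = Real.negMulLog (a+b) / 2 + (a+b)/2 * Real.log 2 := by
    simp only [Real.negMulLog]
    rw [Real.log_div h0.ne' (by norm_num)]
    ring
  rw [e2] at h
  linarith

lemma zeJoin_eq {X : Type*} [MeasurableSpace X] (μ : Measure X) {n : ℕ} (C : Fin n → Set X) :
    joinEntropy μ C = ∑ s : Fin n → Bool, zePhi (μ.real (zeCell C s)) := rfl

lemma zeJoin_snoc {X : Type*} [MeasurableSpace X] (μ : Measure X) {n : ℕ}
    (D : Fin n → Set X) (C : Set X) :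
    joinEntropy μ (Fin.snoc D C : Fin (n+1) → Set X) - joinEntropy μ D =
      ∑ s : Fin n → Bool, (zePhi (μ.real (zeCell D s ∩ C)) + zePhi (μ.real (zeCell D s \ C))
        - zePhi (μ.real (zeCell D s))) := by
  rw [zeJoin_eq, zeJoin_eq, Finset.sum_sub_distrib]
  congr 1
  rw [← (Fin.snocEquiv (fun _ : Fin (n+1) => Bool)).sum_comp, Fintype.sum_prod_type_right]
  refine Finset.sum_congr rfl fun s _ => ?_
  have h (b : Bool) : zeCell (Fin.snoc D C : Fin (n + 1) → Set X)
      ((Fin.snocEquiv (fun _ : Fin (n+1) => Bool)) (b, s)) = _ := zeCell_snoc D C s b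
  simp only [h, Fintype.sum_bool]
  simp [Set.sdiff_eq]

lemma zeCell_mem {X : Type*} {n : ℕ} (D : Fin n → Set X) (x : X) (s : Fin n → Bool) :
    x ∈ zeCell D s ↔ ∀ i, (s i = true ↔ x ∈ D i) := by
  simp only [zeCell, Set.mem_iInter]
  refine forall_congr' fun i => ?_
  cases s i <;> simp

lemma zeCell_cover {X : Type*} {n : ℕ} (D : Fin n → Set X) (x : X) :
    ∃ s, x ∈ zeCell D s := by
  classical
  exact ⟨fun i => decide (x ∈ D i), by simp [zeCell_mem]⟩

lemma zeCell_unique {X : Type*} {n : ℕ} {D : Fin n → Set X} {x : X} {s t : Fin n → Bool}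
    (hs : x ∈ zeCell D s) (ht : x ∈ zeCell D t) : s = t := by
  rw [zeCell_mem] at hs ht
  funext i
  exact Bool.eq_iff_iff.2 ((hs i).trans (ht i).symm)

lemma zeCell_sum {X : Type*} [MeasurableSpace X] (μ : Measure X) [IsProbabilityMeasure μ]
    {n : ℕ} {D : Fin n → Set X} (hD : ∀ i, MeasurableSet (D i)) :
    ∑ s : Fin n → Bool, μ.real (zeCell D s) = 1 := by
  rw [← measureReal_iUnion_fintype]
  · have : (⋃ s, zeCell D s) = Set.univ := by
      ext x; simpa using zeCell_cover D x
    rw [this]; simp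
  · intro s t hst
    refine Set.disjoint_left.2 fun x hs ht => hst (zeCell_unique hs ht)
  · exact fun s => zeCell_meas hD s

lemma zeJoin_step_le {X : Type*} [MeasurableSpace X] (μ : Measure X) [IsProbabilityMeasure μ]
    {n : ℕ} {D : Fin n → Set X} (hD : ∀ i, MeasurableSet (D i)) {C : Set X}
    (hC : MeasurableSet C) :
    joinEntropy μ (Fin.snoc D C : Fin (n+1) → Set X) - joinEntropy μ D ≤ 1 := by
  rw [zeJoin_snoc, ← zeCell_sum μ hD]
  refine Finset.sum_le_sum fun s _ => ?_
  have := measureReal_inter_add_sdiff (μ := μ) (s := zeCell D s) hC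
  rw [← this]
  exact zePhi_upper measureReal_nonneg measureReal_nonneg

/-- Union of cells. -/
def zeUnion {X : Type*} {n : ℕ} (D : Fin n → Set X) (t : (Fin n → Bool) → Bool) : Set X :=
  ⋃ s, ⋃ _ : t s = true, zeCell D s

lemma zeUnion_meas {X : Type*} [MeasurableSpace X] {n : ℕ} {D : Fin n → Set X}
    (hD : ∀ i, MeasurableSet (D i)) (t) : MeasurableSet (zeUnion D t) :=
  MeasurableSet.iUnion fun s => MeasurableSet.iUnion fun _ => zeCell_meas hD s

lemma zeApprox {X : Type*} [MeasurableSpace X] (μ : Measure X) [IsProbabilityMeasure μ]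
    {n : ℕ} (D : Fin n → Set X) {C : Set X} (hC : MeasurableSet C) :
    ∃ t, μ.real (C ∆ zeUnion D t) ≤
      joinEntropy μ (Fin.snoc D C : Fin (n+1) → Set X) - joinEntropy μ D := by
  classical
  let t : (Fin n → Bool) → Bool :=
    fun s => decide (μ.real (zeCell D s \ C) ≤ μ.real (zeCell D s ∩ C))
  refine ⟨t, ?_⟩
  have hsub : C ∆ zeUnion D t ⊆ ⋃ s, if t s then zeCell D s \ C else zeCell D s ∩ C := by
    intro x hx
    obtain ⟨s, hs⟩ := zeCell_cover D x
    have hu : x ∈ zeUnion D t ↔ t s = true := by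
      simp only [zeUnion, Set.mem_iUnion]
      constructor
      · rintro ⟨s', h, h'⟩
        rwa [zeCell_unique hs h']
      · exact fun h => ⟨s, h, hs⟩
    rw [Set.mem_symmDiff, hu] at hx
    refine Set.mem_iUnion.2 ⟨s, ?_⟩
    split_ifs with h
    · simp [h] at hx; exact ⟨hs, hx⟩
    · simp [h] at hx; exact ⟨hs, hx⟩
  refine (measureReal_mono hsub).trans ((measureReal_iUnion_fintype_le _).trans ?_)
  rw [zeJoin_snoc]
  refine Finset.sum_le_sum fun s _ => ?_
  have h := measureReal_inter_add_sdiff (μ := μ) (s := zeCell D s) hC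
  rw [← h]
  refine le_trans ?_ (zePhi_lower measureReal_nonneg measureReal_nonneg)
  by_cases hh : μ.real (zeCell D s \ C) ≤ μ.real (zeCell D s ∩ C)
  · simp [t, hh]
  · simp [t, hh, (not_le.1 hh).le]

noncomputable def zeGreedy {α : Type*} (g : ∀ n, (Fin n → α) → α) : ℕ → α
  | n => g n (fun i => zeGreedy g i.1)
termination_by n => n
decreasing_by exact i.2

lemma zeSeq_snoc {α : Type*} (S : ℕ → α) (n : ℕ) :
    (fun i : Fin (n+1) => S i) = Fin.snoc (fun i : Fin n => S i) (S n) := by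
  funext i
  refine Fin.lastCases ?_ (fun i => ?_) i <;> simp

lemma zeJoin_zero {X : Type*} [MeasurableSpace X] (μ : Measure X) [IsProbabilityMeasure μ]
    (C : Fin 0 → Set X) : joinEntropy μ C = 0 := by
  simp [joinEntropy]

lemma zeJoin_le {X : Type*} [MeasurableSpace X] (μ : Measure X) [IsProbabilityMeasure μ]
    (S : ℕ → Set X) (hS : ∀ i, MeasurableSet (S i)) (n : ℕ) :
    joinEntropy μ (fun i : Fin n => S i) ≤ n := by
  induction n with
  | zero => simp [zeJoin_zero]
  | succ n ih =>
    rw [zeSeq_snoc]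
    have := zeJoin_step_le μ (D := fun i : Fin n => S i) (fun i => hS i) (hS n)
    push_cast
    linarith

lemma zeJoin_nonneg {X : Type*} [MeasurableSpace X] (μ : Measure X) [IsProbabilityMeasure μ]
    {n : ℕ} (C : Fin n → Set X) : 0 ≤ joinEntropy μ C := by
  rw [zeJoin_eq]
  refine Finset.sum_nonneg fun s _ => ?_
  rw [zePhi_eq]
  exact div_nonneg (Real.negMulLog_nonneg measureReal_nonneg measureReal_le_one)
    (Real.log_nonneg (by norm_num))

lemma zeExists {X : Type*} [MeasurableSpace X] (μ : Measure X) [IsProbabilityMeasure μ]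
    (𝒞 : Set (Set X)) (h𝒞 : ∀ C ∈ 𝒞, MeasurableSet C) (hent : famEntropy μ 𝒞 = 0)
    (δ : ℝ) (hδ : 0 < δ) :
    ∃ n, ∃ D : Fin n → 𝒞, ∀ C : 𝒞,
      joinEntropy μ (Fin.snoc (fun i => (D i : Set X)) (C : Set X) : Fin (n+1) → Set X)
        - joinEntropy μ (fun i => (D i : Set X)) < δ := by
  by_contra! hcon
  choose g hg using hcon
  let S : ℕ → 𝒞 := zeGreedy g
  have hSn (n : ℕ) : S n = g n (fun i => S i) := by
    simp only [S]; rw [zeGreedy]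
  have hlow (n : ℕ) : δ * n ≤ joinEntropy μ (fun i : Fin n => (S i : Set X)) := by
    induction n with
    | zero => simp [zeJoin_zero]
    | succ n ih =>
      rw [zeSeq_snoc (fun i => (S i : Set X))]
      have := hg n (fun i => S i)
      rw [← hSn] at this
      push_cast
      linarith
  have hub (T : {f : ℕ → Set X // ∀ i, f i ∈ 𝒞}) (n : ℕ) :
      joinEntropy μ (fun i : Fin n => T.1 i) / n ≤ 1 :=
    div_le_one_of_le₀ (zeJoin_le μ _ (fun i => h𝒞 _ (T.2 i)) n) (Nat.cast_nonneg n)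
  have hlb (T : {f : ℕ → Set X // ∀ i, f i ∈ 𝒞}) (n : ℕ) :
      0 ≤ joinEntropy μ (fun i : Fin n => T.1 i) / n :=
    div_nonneg (zeJoin_nonneg μ _) (Nat.cast_nonneg n)
  have hbdd : BddAbove (Set.range fun T : {f : ℕ → Set X // ∀ i, f i ∈ 𝒞} =>
      Filter.liminf (fun n : ℕ => joinEntropy μ (fun i : Fin n => T.1 i) / n) Filter.atTop) := by
    refine ⟨1, ?_⟩
    rintro _ ⟨T, rfl⟩
    exact Filter.liminf_le_of_frequently_le (Filter.Frequently.of_forall (hub T))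
      (isBoundedUnder_of ⟨0, hlb T⟩)
  let T : {f : ℕ → Set X // ∀ i, f i ∈ 𝒞} := ⟨fun i => S i, fun i => (S i).2⟩
  have h1 := le_ciSup hbdd T
  change _ ≤ famEntropy μ 𝒞 at h1
  rw [hent] at h1
  have h2 : δ ≤ Filter.liminf
      (fun n : ℕ => joinEntropy μ (fun i : Fin n => T.1 i) / n) Filter.atTop := by
    refine Filter.le_liminf_of_le (isCoboundedUnder_ge_of_le _ (hub T)) ?_
    filter_upwards [eventually_ge_atTop 1] with n hn
    rw [le_div_iff₀ (by exact_mod_cast hn)]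
    exact hlow n
  linarith

/-- If the functions `f_n : 𝒮^k → ℝ` are uniformly continuous with respect to `μ` and
`f_n(A₁, …, A_k) → 0` for all measurable `A₁, …, A_k`, and if `H_μ(𝒞) = 0`, then
`sup_{C₁,…,C_k ∈ 𝒞} f_n(C₁, …, C_k) → 0`. -/
theorem uniform_convergence_of_zero_entropy
    {X : Type*} [MeasurableSpace X] (μ : Measure X) [IsProbabilityMeasure μ]
    (k : ℕ) (hk : 1 ≤ k)
    (f : ℕ → (Fin k → {A : Set X // MeasurableSet A}) → ℝ)
    (hUC : ∀ ε > (0 : ℝ), ∃ δ > (0 : ℝ),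
      ∀ A B : Fin k → {A : Set X // MeasurableSet A},
        (∀ i, (μ ((A i : Set X) ∆ (B i : Set X))).toReal < δ) →
          ∀ n : ℕ, 1 ≤ n → |f n A - f n B| < ε)
    (hconv : ∀ A : Fin k → {A : Set X // MeasurableSet A},
      Tendsto (fun n : ℕ => f n A) atTop (nhds 0))
    (𝒞 : Set (Set X)) (h𝒞 : ∀ C ∈ 𝒞, MeasurableSet C) (hent : famEntropy μ 𝒞 = 0) :
    Tendsto
      (fun n : ℕ =>
        ⨆ A : {g : Fin k → {A : Set X // MeasurableSet A} // ∀ i, (g i : Set X) ∈ 𝒞},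
          f n A)
      atTop (nhds 0) := by
  rw [Metric.tendsto_atTop]
  intro ε hε
  obtain ⟨δ, hδ, hd⟩ := hUC (ε / 4) (by positivity)
  obtain ⟨m, D, hD⟩ := zeExists μ 𝒞 h𝒞 hent δ hδ
  have hDm : ∀ i, MeasurableSet ((fun i => (D i : Set X)) i) := fun i => h𝒞 _ (D i).2
  let B : (Fin k → (Fin m → Bool) → Bool) → Fin k → {A : Set X // MeasurableSet A} :=
    fun t i => ⟨zeUnion (fun i => (D i : Set X)) (t i), zeUnion_meas hDm _⟩
  have hev : ∀ᶠ n in atTop, ∀ t, |f n (B t)| < ε / 4 := by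
    rw [eventually_all]
    intro t
    have := (Metric.tendsto_nhds.1 (hconv (B t))) (ε / 4) (by positivity)
    simpa [Real.dist_eq] using this
  obtain ⟨N, hN⟩ := eventually_atTop.1 (hev.and (eventually_ge_atTop 1))
  refine ⟨N, fun n hn => ?_⟩
  obtain ⟨h1, h2⟩ := hN n hn
  have key : ∀ A : {g : Fin k → {A : Set X // MeasurableSet A} // ∀ i, (g i : Set X) ∈ 𝒞},
      |f n A| ≤ ε / 2 := by
    intro A
    have hch : ∀ i, ∃ t, μ.real ((A.1 i : Set X) ∆ zeUnion (fun i => (D i : Set X)) t) < δ := by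
      intro i
      obtain ⟨t, ht⟩ := zeApprox μ (fun i => (D i : Set X)) (A.1 i).2
      exact ⟨t, ht.trans_lt (hD ⟨_, A.2 i⟩)⟩
    choose t ht using hch
    have h3 := hd A.1 (B t) ht n h2
    have h4 := h1 t
    rw [abs_lt] at h3 h4
    rw [abs_le]
    constructor <;> linarith
  rw [Real.dist_eq, sub_zero]
  refine lt_of_le_of_lt ?_ (half_lt_self hε)
  rcases isEmpty_or_nonempty
    {g : Fin k → {A : Set X // MeasurableSet A} // ∀ i, (g i : Set X) ∈ 𝒞} with he | ⟨a⟩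
  · rw [Real.iSup_of_isEmpty]; simp; positivity
  · obtain ⟨a⟩ := a
    have : Nonempty {g : Fin k → {A : Set X // MeasurableSet A} // ∀ i, (g i : Set X) ∈ 𝒞} :=
      ⟨a⟩
    rw [abs_le]
    constructor
    · exact (abs_le.1 (key a)).1.trans
        (le_ciSup (f := fun A : {g : Fin k → {A : Set X // MeasurableSet A} //
          ∀ i, (g i : Set X) ∈ 𝒞} => f n A)
          ⟨ε / 2, by rintro _ ⟨A, rfl⟩; exact (abs_le.1 (key A)).2⟩ a)
    · exact ciSup_le fun A => (abs_le.1 (key A)).2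
end
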